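/- arXiv:1411.0266 — 9 statements merged into one kernel-verified Lean document; each statement's English description precedes it below -/
import Mathlib

section
/- Let (P, 𝓑) be a nontrivial pairwise balanced design on n points (n ≥ 3). Then the sum of the block sizes satisfies Σ_{B ∈ 𝓑} |B| ≥ 3n − 3. -/
/-- A pairwise balanced design (PBD): `B` is a family of subsets of `P`, each of
size at least `2`, such that every pair of distinct points of `P` is contained
in exactly one block. -/
def IsPBD {α : Type*} [DecidableEq α] (P : Finset α) (B : Finset (Finset α)) : Prop :=
  (∀ b ∈ B, b ⊆ P ∧ 2 ≤ b.card) ∧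
    ∀ x ∈ P, ∀ y ∈ P, x ≠ y → ∃! b, b ∈ B ∧ x ∈ b ∧ y ∈ b

/-- A PBD is nontrivial if no block equals the whole point set. -/
def IsNontrivialPBD {α : Type*} [DecidableEq α] (P : Finset α) (B : Finset (Finset α)) : Prop :=
  IsPBD P B ∧ ∀ b ∈ B, b ≠ P

namespace IsPBD

variable {α : Type*} [DecidableEq α] {P : Finset α} {B : Finset (Finset α)}

theorem eq_of_mem (h : IsPBD P B) {b c : Finset α} (hb : b ∈ B) (hc : c ∈ B) {x y : α}
    (hxy : x ≠ y) (hxb : x ∈ b) (hyb : y ∈ b) (hxc : x ∈ c) (hyc : y ∈ c) : b = c :=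
  (h.2 x ((h.1 b hb).1 hxb) y ((h.1 b hb).1 hyb) hxy).unique ⟨hb, hxb, hyb⟩ ⟨hc, hxc, hyc⟩

/-- The replication numbers of the points sum to the total block size. -/
theorem sum_card_filter_mem (h : IsPBD P B) :
    ∑ x ∈ P, (B.filter (x ∈ ·)).card = ∑ b ∈ B, b.card := by
  have key := Finset.sum_card_bipartiteAbove_eq_sum_card_bipartiteBelow
    (s := P) (t := B) (fun x b => x ∈ b)
  refine key.trans (Finset.sum_congr rfl fun b hb => ?_)
  rw [Finset.bipartiteBelow, Finset.filter_mem_eq_inter,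
    Finset.inter_eq_right.2 (h.1 b hb).1]

/-- A point outside a block lies on at least as many blocks as that block has points. -/
theorem card_le_card_filter_mem (h : IsPBD P B) {b : Finset α} (hb : b ∈ B) {y : α}
    (hyP : y ∈ P) (hyb : y ∉ b) : b.card ≤ (B.filter (y ∈ ·)).card := by
  have hex : ∀ z ∈ b, ∃ c ∈ B, y ∈ c ∧ z ∈ c := fun z hz =>
    (h.2 y hyP z ((h.1 b hb).1 hz) (ne_of_mem_of_not_mem hz hyb).symm).exists
  choose! f hfB hyf hzf using hex
  refine Finset.card_le_card_of_injOn f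
    (fun z hz => by simpa using ⟨hfB z hz, hyf z hz⟩) fun z hz w hw hzw => ?_
  by_contra hne
  have hfb := h.eq_of_mem (hfB z hz) hb hne (hzf z hz) (hzw ▸ hzf w hw) hz hw
  exact hyb (hfb ▸ hyf z hz)

end IsPBD

namespace IsNontrivialPBD

variable {α : Type*} [DecidableEq α] {P : Finset α} {B : Finset (Finset α)}

/-- Every point of a nontrivial PBD on at least two points lies on two distinct blocks. -/
theorem exists_ne_of_mem (h : IsNontrivialPBD P B) (hP : 1 < P.card) {x : α} (hx : x ∈ P) :
    ∃ a ∈ B, ∃ c ∈ B, a ≠ c ∧ x ∈ a ∧ x ∈ c := by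
  obtain ⟨y, hy, hyx⟩ := Finset.exists_mem_ne hP x
  obtain ⟨a, ha, hxa, -⟩ := (h.1.2 x hx y hy hyx.symm).exists
  obtain ⟨z, hz, hza⟩ := Finset.exists_of_ssubset ((h.1.1 a ha).1.ssubset_of_ne (h.2 a ha))
  obtain ⟨c, hc, hxc, hzc⟩ := (h.1.2 x hx z hz (ne_of_mem_of_not_mem hxa hza)).exists
  exact ⟨a, ha, c, hc, fun hac => hza (hac ▸ hzc), hxa, hxc⟩

/-- The bound in the case where some point lies on at most two blocks. -/
theorem le_sum_card_of_card_filter_mem_le_two (h : IsNontrivialPBD P B) (hP : 1 < P.card)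
    {x : α} (hx : x ∈ P) (hr : (B.filter (x ∈ ·)).card ≤ 2) :
    3 * P.card ≤ (∑ b ∈ B, b.card) + 3 := by
  obtain ⟨a, ha, c, hc, hac, hxa, hxc⟩ := h.exists_ne_of_mem hP hx
  have hpair : {a, c} = B.filter (x ∈ ·) := by
    refine Finset.eq_of_subset_of_card_le ?_ (by rwa [Finset.card_pair hac])
    simp [Finset.insert_subset_iff, ha, hc, hxa, hxc]
  have hinter : ∀ y, y ≠ x → y ∈ a → y ∉ c := fun y hyx hya hyc =>
    hac (h.1.eq_of_mem ha hc hyx hya hxa hyc hxc)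
  have hdisj : Disjoint (a.erase x) (c.erase x) := Finset.disjoint_left.2 fun y hy hy' =>
    hinter y (Finset.ne_of_mem_erase hy) (Finset.mem_of_mem_erase hy) (Finset.mem_of_mem_erase hy')
  have hunion : P.erase x = a.erase x ∪ c.erase x := by
    rw [← Finset.erase_union_distrib]
    refine congrArg (Finset.erase · x) (Finset.Subset.antisymm (fun y hy => ?_)
      (Finset.union_subset (h.1.1 a ha).1 (h.1.1 c hc).1))
    by_cases hyx : y = x
    · simp [hyx, hxa]
    obtain ⟨b, hb, hxb, hyb⟩ := (h.1.2 x hx y hy (Ne.symm hyx)).exists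
    have hmem : b ∈ ({a, c} : Finset (Finset α)) := by simp [hpair, hb, hxb]
    rcases Finset.mem_insert.1 hmem with rfl | hbc
    · exact Finset.mem_union_left _ hyb
    · exact Finset.mem_union_right _ (Finset.mem_singleton.1 hbc ▸ hyb)
  have hsum_a : (a.erase x).card * c.card ≤ ∑ y ∈ a.erase x, (B.filter (y ∈ ·)).card := by
    refine Finset.card_nsmul_le_sum _ _ _ fun y hy => ?_
    obtain ⟨hyx, hya⟩ := Finset.mem_erase.1 hy
    exact h.1.card_le_card_filter_mem hc ((h.1.1 a ha).1 hya) (hinter y hyx hya)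
  have hsum_c : (c.erase x).card * a.card ≤ ∑ y ∈ c.erase x, (B.filter (y ∈ ·)).card := by
    refine Finset.card_nsmul_le_sum _ _ _ fun y hy => ?_
    obtain ⟨hyx, hyc⟩ := Finset.mem_erase.1 hy
    exact h.1.card_le_card_filter_mem ha ((h.1.1 c hc).1 hyc) fun hya => hinter y hyx hya hyc
  have hcard := congrArg Finset.card hunion
  rw [Finset.card_union_of_disjoint hdisj] at hcard
  rw [← h.1.sum_card_filter_mem, ← Finset.add_sum_erase _ _ hx, hunion,
    Finset.sum_union hdisj, ← hpair, Finset.card_pair hac]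
  have hPx := Finset.card_erase_add_one hx
  have hax := Finset.card_erase_add_one hxa
  have hcx := Finset.card_erase_add_one hxc
  have ha2 := (h.1.1 a ha).2
  have hc2 := (h.1.1 c hc).2
  nlinarith [Nat.mul_le_mul (show 1 ≤ (a.erase x).card by omega)
    (show 1 ≤ (c.erase x).card by omega), mul_nonneg
    (show (0 : ℤ) ≤ (a.erase x).card - 1 by omega) (show (0 : ℤ) ≤ (c.erase x).card - 1 by omega)]

end IsNontrivialPBD

theorem pbd_sum_ge_three_n_sub_three {α : Type*} [DecidableEq α] (n : ℕ) (hn : 3 ≤ n)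
    (P : Finset α) (B : Finset (Finset α)) (hP : P.card = n)
    (h : IsNontrivialPBD P B) :
    3 * n - 3 ≤ ∑ b ∈ B, b.card := by
  subst hP
  by_cases hr : ∃ x ∈ P, (B.filter (x ∈ ·)).card ≤ 2
  · obtain ⟨x, hx, hr⟩ := hr
    have := h.le_sum_card_of_card_filter_mem_le_two (by omega) hx hr
    omega
  · push Not at hr
    have := Finset.card_nsmul_le_sum P _ 3 hr
    rw [h.1.sum_card_filter_mem, smul_eq_mul] at this
    omega
end

section
/- Let (P, 𝓑) be a nontrivial pairwise balanced design on n points (n ≥ 3). Then Σ_{B ∈ 𝓑} |B| = 3n − 3 if and only if (P, 𝓑) is a near-pencil, equivalently, if and only if 𝓑 contains a block of size n − 1. -/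
/-- A near-pencil on `P`: one block consisting of all points but one point `x`,
together with all blocks `{x, y}` for `y ≠ x`. -/
def IsNearPencil {α : Type*} [DecidableEq α] (P : Finset α) (B : Finset (Finset α)) : Prop :=
  ∃ x ∈ P, B = insert (P.erase x) ((P.erase x).image fun y => ({x, y} : Finset α))

namespace IsPBD

variable {α : Type*} [DecidableEq α] {P : Finset α} {B : Finset (Finset α)}

theorem exists_block (h : IsPBD P B) {x y : α} (hx : x ∈ P) (hy : y ∈ P) (hxy : x ≠ y) :
    ∃ b ∈ B, x ∈ b ∧ y ∈ b :=
  (h.2 x hx y hy hxy).exists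

/-- Double counting of incident point-block pairs. -/
theorem sum_card_eq_sum_degree (h : IsPBD P B) :
    ∑ b ∈ B, b.card = ∑ x ∈ P, (B.filter fun b => x ∈ b).card := by
  have key := Finset.sum_card_bipartiteAbove_eq_sum_card_bipartiteBelow
    (s := P) (t := B) (fun x b => x ∈ b)
  simp only [Finset.bipartiteAbove, Finset.bipartiteBelow] at key
  rw [key]
  refine Finset.sum_congr rfl fun b hb => ?_
  rw [Finset.filter_mem_eq_inter, Finset.inter_eq_right.2 (h.1 b hb).1]

/-- A block missing exactly one point forces a near-pencil. -/
theorem isNearPencil_of_erase_mem (h : IsPBD P B) {x : α} (hx : x ∈ P) (hL : P.erase x ∈ B) :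
    IsNearPencil P B := by
  have pair_mem : ∀ b ∈ B, ∀ y ∈ P.erase x, x ∈ b → y ∈ b → b = {x, y} := by
    intro b hb y hy hxb hyb
    ext z
    simp only [Finset.mem_insert, Finset.mem_singleton]
    refine ⟨fun hz => ?_, by rintro (rfl | rfl) <;> assumption⟩
    by_contra! hzxy
    have := h.eq_of_mem hb hL hzxy.2 hz hyb
      (Finset.mem_erase.2 ⟨hzxy.1, (h.1 b hb).1 hz⟩) hy
    exact Finset.notMem_erase x P (this ▸ hxb)
  refine ⟨x, hx, Finset.Subset.antisymm (fun b hb => ?_) (fun b hb => ?_)⟩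
  · obtain ⟨u, hu, v, hv, huv⟩ := Finset.one_lt_card.1 (h.1 b hb).2
    have huP := (h.1 b hb).1 hu
    have hvP := (h.1 b hb).1 hv
    rw [Finset.mem_insert, Finset.mem_image]
    by_cases hux : u = x
    · subst hux
      have hv' := Finset.mem_erase.2 ⟨huv.symm, hvP⟩
      exact Or.inr ⟨v, hv', (pair_mem b hb v hv' hu hv).symm⟩
    · have hu' := Finset.mem_erase.2 ⟨hux, huP⟩
      by_cases hvx : v = x
      · subst hvx
        exact Or.inr ⟨u, hu', (pair_mem b hb u hu' hv hu).symm⟩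
      · exact Or.inl (h.eq_of_mem hb hL huv hu hv hu' (Finset.mem_erase.2 ⟨hvx, hvP⟩))
  · rw [Finset.mem_insert, Finset.mem_image] at hb
    obtain rfl | ⟨y, hy, rfl⟩ := hb
    · exact hL
    · obtain ⟨b, hb, hxb, hyb⟩ :=
        h.exists_block hx (Finset.mem_of_mem_erase hy) (Finset.ne_of_mem_erase hy).symm
      exact pair_mem b hb y hy hxb hyb ▸ hb

/-- If `x` lies on exactly the two blocks `A` and `C`, then the remaining blocks are the pairs
joining a point of `A` to a point of `C`. -/
theorem eq_insert_insert_image (h : IsPBD P B) {x : α} (hx : x ∈ P) {A C : Finset α}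
    (hA : A ∈ B) (hC : C ∈ B) (hxA : x ∈ A) (hxC : x ∈ C) (hAC : A ≠ C)
    (hdeg : ∀ b ∈ B, x ∈ b → b = A ∨ b = C) :
    B = insert A (insert C
      ((A.erase x ×ˢ C.erase x).image fun p => ({p.1, p.2} : Finset α))) := by
  have cover : ∀ y ∈ P, y ∈ A ∨ y ∈ C := by
    intro y hy
    by_cases hyx : y = x
    · exact Or.inl (hyx ▸ hxA)
    · obtain ⟨b, hb, hxb, hyb⟩ := h.exists_block hx hy (Ne.symm hyx)
      obtain rfl | rfl := hdeg b hb hxb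
      exacts [Or.inl hyb, Or.inr hyb]
  have not_both : ∀ y, y ≠ x → y ∈ A → y ∉ C := fun y hyx hyA hyC =>
    hAC (h.eq_of_mem hA hC hyx hyA hxA hyC hxC)
  have pair_mem : ∀ b ∈ B, b ≠ A → b ≠ C → ∀ y ∈ A, ∀ z ∈ C, y ∈ b → z ∈ b →
      b = {y, z} := by
    intro b hb hbA hbC y hyA z hzC hyb hzb
    ext w
    simp only [Finset.mem_insert, Finset.mem_singleton]
    refine ⟨fun hw => ?_, by rintro (rfl | rfl) <;> assumption⟩
    by_contra! hw'
    rcases cover w ((h.1 b hb).1 hw) with hwA | hwC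
    · exact hbA (h.eq_of_mem hb hA hw'.1 hw hyb hwA hyA)
    · exact hbC (h.eq_of_mem hb hC hw'.2 hw hzb hwC hzC)
  refine Finset.Subset.antisymm (fun b hb => ?_) (fun b hb => ?_)
  · rw [Finset.mem_insert, Finset.mem_insert, Finset.mem_image]
    by_cases hbA : b = A
    · exact Or.inl hbA
    by_cases hbC : b = C
    · exact Or.inr (Or.inl hbC)
    refine Or.inr (Or.inr ?_)
    have hxb : x ∉ b := fun hxb => (hdeg b hb hxb).elim hbA hbC
    have ne_x : ∀ y ∈ b, y ≠ x := fun y hy e => hxb (e ▸ hy)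
    obtain ⟨u, hu, v, hv, huv⟩ := Finset.one_lt_card.1 (h.1 b hb).2
    have join : ∀ y ∈ b, ∀ z ∈ b, y ∈ A → z ∈ C →
        ∃ p ∈ A.erase x ×ˢ C.erase x, ({p.1, p.2} : Finset α) = b := fun y hy z hz hyA hzC =>
      ⟨(y, z), Finset.mem_product.2 ⟨Finset.mem_erase.2 ⟨ne_x y hy, hyA⟩,
        Finset.mem_erase.2 ⟨ne_x z hz, hzC⟩⟩,
        (pair_mem b hb hbA hbC y hyA z hzC hy hz).symm⟩
    rcases cover u ((h.1 b hb).1 hu) with huA | huC <;>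
      rcases cover v ((h.1 b hb).1 hv) with hvA | hvC
    · exact absurd (h.eq_of_mem hb hA huv hu hv huA hvA) hbA
    · exact join u hu v hv huA hvC
    · exact join v hv u hu hvA huC
    · exact absurd (h.eq_of_mem hb hC huv hu hv huC hvC) hbC
  · rw [Finset.mem_insert, Finset.mem_insert, Finset.mem_image] at hb
    obtain rfl | rfl | ⟨⟨y, z⟩, hyz, rfl⟩ := hb
    · exact hA
    · exact hC
    · obtain ⟨hy, hz⟩ := Finset.mem_product.1 hyz
      obtain ⟨hyx, hyA⟩ := Finset.mem_erase.1 hy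
      obtain ⟨hzx, hzC⟩ := Finset.mem_erase.1 hz
      have hyC := not_both y hyx hyA
      have hzA : z ∉ A := fun hzA => not_both z hzx hzA hzC
      obtain ⟨b, hb, hyb, hzb⟩ := h.exists_block ((h.1 A hA).1 hyA) ((h.1 C hC).1 hzC)
        (ne_of_mem_of_not_mem hzC hyC).symm
      have hbA : b ≠ A := fun e => hzA (e ▸ hzb)
      have hbC : b ≠ C := fun e => hyC (e ▸ hyb)
      exact pair_mem b hb hbA hbC y hyA z hzC hyb hzb ▸ hb

/-- The sum of the block sizes when some point lies on exactly two blocks. -/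
theorem sum_card_of_two_blocks (h : IsPBD P B) {x : α} (hx : x ∈ P) {A C : Finset α}
    (hA : A ∈ B) (hC : C ∈ B) (hxA : x ∈ A) (hxC : x ∈ C) (hAC : A ≠ C)
    (hdeg : ∀ b ∈ B, x ∈ b → b = A ∨ b = C) :
    ∑ b ∈ B, b.card = A.card + C.card + 2 * ((A.card - 1) * (C.card - 1)) := by
  have not_both : ∀ y, y ≠ x → y ∈ A → y ∉ C := fun y hyx hyA hyC =>
    hAC (h.eq_of_mem hA hC hyx hyA hxA hyC hxC)
  have x_notMem : ∀ b, x ∈ b →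
      b ∉ (A.erase x ×ˢ C.erase x).image fun p => ({p.1, p.2} : Finset α) := by
    intro b hxb hb
    obtain ⟨⟨y, z⟩, hyz, rfl⟩ := Finset.mem_image.1 hb
    simp only [Finset.mem_product, Finset.mem_erase] at hyz
    simp only [Finset.mem_insert, Finset.mem_singleton] at hxb
    exact hxb.elim (fun e => hyz.1.1 e.symm) (fun e => hyz.2.1 e.symm)
  rw [h.eq_insert_insert_image hx hA hC hxA hxC hAC hdeg, Finset.sum_insert, Finset.sum_insert
    (x_notMem C hxC), Finset.sum_image, Finset.sum_const_nat (m := 2), Finset.card_product,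
    Finset.card_erase_of_mem hxA, Finset.card_erase_of_mem hxC]
  · ring
  · rintro ⟨y, z⟩ hyz
    simp only [Finset.mem_product, Finset.mem_erase] at hyz
    exact Finset.card_pair
      (ne_of_mem_of_not_mem hyz.2.2 (not_both y hyz.1.1 hyz.1.2)).symm
  · rintro ⟨y, z⟩ hyz ⟨y', z'⟩ hyz' e
    simp only [Finset.coe_product, Set.mem_prod, Finset.mem_coe, Finset.mem_erase] at hyz hyz'
    have hy : y ∈ ({y', z'} : Finset α) := by
      rw [← show ({y, z} : Finset α) = {y', z'} from e]; simp
    have hz : z ∈ ({y', z'} : Finset α) := by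
      rw [← show ({y, z} : Finset α) = {y', z'} from e]; simp
    simp only [Finset.mem_insert, Finset.mem_singleton] at hy hz
    have hyy : y = y' :=
      hy.resolve_right fun e => not_both y hyz.1.1 hyz.1.2 (e ▸ hyz'.2.2)
    have hzz : z = z' :=
      hz.resolve_left fun e => not_both z hyz.2.1 (e ▸ hyz'.1.2) hyz.2.2
    rw [hyy, hzz]
  · rw [Finset.mem_insert, not_or]
    exact ⟨hAC, x_notMem A hxA⟩

end IsPBD

theorem IsNearPencil.sum_card {α : Type*} [DecidableEq α] {P : Finset α}
    {B : Finset (Finset α)} (h : IsNearPencil P B) :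
    ∑ b ∈ B, b.card = 3 * (P.card - 1) := by
  obtain ⟨x, hx, rfl⟩ := h
  rw [Finset.sum_insert, Finset.sum_image, Finset.sum_const_nat (m := 2),
    Finset.card_erase_of_mem hx]
  · ring
  · exact fun y hy => Finset.card_pair (Finset.ne_of_mem_erase hy).symm
  · intro y hy z hz e
    have hy' : y ∈ ({x, z} : Finset α) := by
      rw [← show ({x, y} : Finset α) = {x, z} from e]; simp
    simp only [Finset.mem_insert, Finset.mem_singleton] at hy'
    exact hy'.resolve_left (Finset.ne_of_mem_erase hy)
  · intro hmem
    obtain ⟨y, -, e⟩ := Finset.mem_image.1 hmem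
    exact Finset.notMem_erase x P (e ▸ Finset.mem_insert_self x {y})

/-- If the block sizes sum to less than `3 * n`, some point lies on exactly two blocks. -/
theorem IsNontrivialPBD.exists_two_blocks {α : Type*} [DecidableEq α] {P : Finset α}
    {B : Finset (Finset α)} (h : IsNontrivialPBD P B) (hP : 2 ≤ P.card)
    (hsum : ∑ b ∈ B, b.card < 3 * P.card) :
    ∃ x ∈ P, ∃ A ∈ B, ∃ C ∈ B, x ∈ A ∧ x ∈ C ∧ A ≠ C ∧
      ∀ b ∈ B, x ∈ b → b = A ∨ b = C := by
  obtain ⟨h, hne⟩ := h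
  obtain ⟨x, hx, hdeg⟩ : ∃ x ∈ P, (B.filter fun b => x ∈ b).card < 3 := by
    refine Finset.exists_lt_of_sum_lt ?_
    rw [← h.sum_card_eq_sum_degree, Finset.sum_const, smul_eq_mul, mul_comm]
    exact hsum
  obtain ⟨y, hy, hyx⟩ := Finset.exists_mem_ne hP x
  obtain ⟨A, hA, hxA, -⟩ := h.exists_block hx hy hyx.symm
  obtain ⟨z, hz, hzA⟩ := Finset.exists_of_ssubset ((h.1 A hA).1.ssubset_of_ne (hne A hA))
  obtain ⟨C, hC, hxC, hzC⟩ := h.exists_block hx hz (fun e => hzA (e ▸ hxA))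
  have hAC : A ≠ C := fun e => hzA (e ▸ hzC)
  refine ⟨x, hx, A, hA, C, hC, hxA, hxC, hAC, fun b hb hxb => ?_⟩
  have heq : {A, C} = B.filter fun b => x ∈ b := by
    refine Finset.eq_of_subset_of_card_le ?_ ?_
    · simp [Finset.insert_subset_iff, hA, hC, hxA, hxC]
    · rw [Finset.card_pair hAC]; omega
  have hmem : b ∈ B.filter fun b => x ∈ b := Finset.mem_filter.2 ⟨hb, hxb⟩
  rw [← heq] at hmem
  simpa using hmem

theorem pbd_sum_eq_three_n_sub_three_iff {α : Type*} [DecidableEq α] (n : ℕ) (hn : 3 ≤ n)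
    (P : Finset α) (B : Finset (Finset α)) (hP : P.card = n)
    (h : IsNontrivialPBD P B) :
    ((∑ b ∈ B, b.card = 3 * n - 3) ↔ IsNearPencil P B) ∧
      ((∑ b ∈ B, b.card = 3 * n - 3) ↔ ∃ b ∈ B, b.card = n - 1) := by
  have sum_of_pencil : IsNearPencil P B → ∑ b ∈ B, b.card = 3 * n - 3 := fun hB => by
    rw [hB.sum_card, hP]; omega
  have pencil_of_block : (∃ b ∈ B, b.card = n - 1) → IsNearPencil P B := by
    rintro ⟨b, hb, hcard⟩
    obtain ⟨x, hx, hxb⟩ :=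
      Finset.exists_of_ssubset ((h.1.1 b hb).1.ssubset_of_ne (h.2 b hb))
    have hbx : b = P.erase x := Finset.eq_of_subset_of_card_le
      (Finset.subset_erase.2 ⟨(h.1.1 b hb).1, hxb⟩)
      (by rw [Finset.card_erase_of_mem hx, hP, hcard])
    exact h.1.isNearPencil_of_erase_mem hx (hbx ▸ hb)
  have block_of_sum : ∑ b ∈ B, b.card = 3 * n - 3 → ∃ b ∈ B, b.card = n - 1 := by
    intro hsum
    obtain ⟨x, hx, A, hA, C, hC, hxA, hxC, hAC, hdeg⟩ :=
      h.exists_two_blocks (by omega) (by omega)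
    have hcount := h.1.sum_card_of_two_blocks hx hA hC hxA hxC hAC hdeg
    have hunion : A ∪ C = P := by
      refine Finset.Subset.antisymm
        (Finset.union_subset (h.1.1 A hA).1 (h.1.1 C hC).1) fun y hy => ?_
      by_cases hyx : y = x
      · exact Finset.mem_union_left _ (hyx ▸ hxA)
      · obtain ⟨b, hb, hxb, hyb⟩ := h.1.exists_block hx hy (Ne.symm hyx)
        obtain rfl | rfl := hdeg b hb hxb
        exacts [Finset.mem_union_left _ hyb, Finset.mem_union_right _ hyb]
    have hinter : A ∩ C = {x} := by
      ext y
      rw [Finset.mem_inter, Finset.mem_singleton]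
      refine ⟨fun hy => ?_, by rintro rfl; exact ⟨hxA, hxC⟩⟩
      by_contra hyx
      exact hAC (h.1.eq_of_mem hA hC hyx hy.1 hxA hy.2 hxC)
    have hcard := Finset.card_union_add_card_inter A C
    rw [hunion, hinter, hP, Finset.card_singleton] at hcard
    obtain ⟨a, ha⟩ := Nat.exists_eq_add_of_le (h.1.1 A hA).2
    obtain ⟨c, hc⟩ := Nat.exists_eq_add_of_le (h.1.1 C hC).2
    have hac : a * c = 0 := by
      rw [hsum, ha, hc, show 2 + a - 1 = a + 1 by omega, show 2 + c - 1 = c + 1 by omega,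
        show (a + 1) * (c + 1) = a * c + a + c + 1 by ring] at hcount
      omega
    rcases Nat.mul_eq_zero.1 hac with h0 | h0
    · exact ⟨C, hC, by omega⟩
    · exact ⟨A, hA, by omega⟩
  exact ⟨⟨fun hs => pencil_of_block (block_of_sum hs), sum_of_pencil⟩,
    ⟨block_of_sum, fun hb => sum_of_pencil (pencil_of_block hb)⟩⟩
end

section
/- Let n ≥ 3 and let 𝒞 be a clique partition of the complete graph K_n in which every clique has size at most n − 1. Then Σ_{C ∈ 𝒞} |C| ≥ 3n − 3. -/
/-- A clique partition of a graph `G`: a family of cliques such that every edge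
of `G` lies in exactly one member. -/
def IsCliquePartition {V : Type*} (G : SimpleGraph V) (C : Finset (Finset V)) : Prop :=
  (∀ c ∈ C, G.IsClique (c : Set V)) ∧
    ∀ x y, G.Adj x y → ∃! c, c ∈ C ∧ x ∈ c ∧ y ∈ c

/-- The sigma clique partition number: the minimum of the sum of clique sizes
over all clique partitions of `G`. -/
noncomputable def scp {V : Type*} [Fintype V] (G : SimpleGraph V) : ℕ :=
  sInf {s | ∃ C : Finset (Finset V), IsCliquePartition G C ∧ s = ∑ c ∈ C, c.card}

open Finset in
/-- In a clique partition of a complete graph, a vertex outside a member `b` lies in at least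
`#b` members. -/
theorem IsCliquePartition.card_le_card_filter_mem {V : Type*} [DecidableEq V]
    {C : Finset (Finset V)} (hC : IsCliquePartition (⊤ : SimpleGraph V) C)
    {b : Finset V} (hb : b ∈ C) {y : V} (hy : y ∉ b) :
    b.card ≤ (C.filter (y ∈ ·)).card := by
  have hex : ∀ z ∈ b, ∃ c ∈ C, y ∈ c ∧ z ∈ c := fun z hz => by
    obtain ⟨c, hc, -⟩ := hC.2 y z (by rintro rfl; exact hy hz)
    exact ⟨c, hc⟩
  choose! f hfC hfy hfz using hex
  refine card_le_card_of_injOn f (fun z hz => ?_) (fun z hz w hw hzw => ?_)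
  · simpa using ⟨hfC z hz, hfy z hz⟩
  · by_contra hne
    have hfb : f z = b := (hC.2 z w hne).unique
      ⟨hfC z hz, hfz z hz, hzw ▸ hfz w hw⟩ ⟨hb, hz, hw⟩
    exact hy (hfb ▸ hfy z hz)

open Finset in
/-- If some vertex of a complete graph lies in exactly the two members `a` and `b` of a clique
partition, and both are proper, then the member sizes add up to at least `3n - 3`. -/
theorem IsCliquePartition.sum_card_filter_mem_ge {n : ℕ}
    {C : Finset (Finset (Fin n))} (hC : IsCliquePartition (⊤ : SimpleGraph (Fin n)) C)
    {x : Fin n} {a b : Finset (Fin n)} (hab : a ≠ b) (ha : 2 ≤ a.card) (hb : 2 ≤ b.card)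
    (hx : C.filter (x ∈ ·) = {a, b}) :
    3 * n - 3 ≤ ∑ y, (C.filter (y ∈ ·)).card := by
  obtain ⟨haC, hxa⟩ : a ∈ C ∧ x ∈ a :=
    (mem_filter (p := (x ∈ ·))).1 (by rw [hx]; simp)
  obtain ⟨hbC, hxb⟩ : b ∈ C ∧ x ∈ b :=
    (mem_filter (p := (x ∈ ·))).1 (by rw [hx]; simp)
  have hunion : a ∪ b = univ := by
    ext y
    simp only [mem_union, mem_univ, iff_true]
    by_cases hxy : x = y
    · exact Or.inl (hxy ▸ hxa)
    obtain ⟨c, ⟨hcC, hxc, hyc⟩, -⟩ := hC.2 x y hxy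
    have hc : c ∈ ({a, b} : Finset (Finset (Fin n))) := hx ▸ mem_filter.2 ⟨hcC, hxc⟩
    rcases mem_insert.1 hc with rfl | hc
    · exact Or.inl hyc
    · exact Or.inr (mem_singleton.1 hc ▸ hyc)
  have hinter : a ∩ b = {x} := by
    refine eq_singleton_iff_unique_mem.2 ⟨mem_inter.2 ⟨hxa, hxb⟩, fun y hy => ?_⟩
    by_contra hne
    have hy := mem_inter.1 hy
    exact hab ((hC.2 y x hne).unique ⟨haC, hy.1, hxa⟩ ⟨hbC, hy.2, hxb⟩)
  have hcard := card_union_add_card_inter a b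
  rw [hunion, hinter, card_univ, Fintype.card_fin, card_singleton] at hcard
  have hdisj : Disjoint aᶜ bᶜ := by
    rw [disjoint_iff_inter_eq_empty, ← compl_union, hunion, compl_univ]
  have hx' : x ∉ aᶜ ∪ bᶜ := by simp [hxa, hxb]
  have hsum : 2 + (aᶜ.card * a.card + bᶜ.card * b.card) ≤ ∑ y, (C.filter (y ∈ ·)).card := by
    calc _ ≤ (C.filter (x ∈ ·)).card + (∑ y ∈ aᶜ, (C.filter (y ∈ ·)).card +
            ∑ y ∈ bᶜ, (C.filter (y ∈ ·)).card) := by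
          rw [hx, card_pair hab]
          gcongr
          · exact card_nsmul_le_sum _ _ _ fun y hy =>
              hC.card_le_card_filter_mem haC (mem_compl.1 hy)
          · exact card_nsmul_le_sum _ _ _ fun y hy =>
              hC.card_le_card_filter_mem hbC (mem_compl.1 hy)
      _ = ∑ y ∈ insert x (aᶜ ∪ bᶜ), (C.filter (y ∈ ·)).card := by
          rw [sum_insert hx', sum_union hdisj]
      _ ≤ _ := sum_le_sum_of_subset (subset_univ _)
  have hac : aᶜ.card = b.card - 1 := by rw [card_compl, Fintype.card_fin]; omega
  have hbc : bᶜ.card = a.card - 1 := by rw [card_compl, Fintype.card_fin]; omega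
  rw [hac, hbc] at hsum
  obtain ⟨p, hp⟩ := Nat.exists_eq_add_of_le ha
  obtain ⟨q, hq⟩ := Nat.exists_eq_add_of_le hb
  have hp' : a.card - 1 = 1 + p := by omega
  have hq' : b.card - 1 = 1 + q := by omega
  rw [hp', hq', hp, hq] at hsum
  have hn : n = p + q + 3 := by omega
  have : 3 * n - 3 = 3 * (p + q) + 6 := by omega
  nlinarith [Nat.zero_le (p * q)]

theorem cliquePartition_complete_sum_ge (n : ℕ) (hn : 3 ≤ n)
    (C : Finset (Finset (Fin n)))
    (hC : IsCliquePartition (⊤ : SimpleGraph (Fin n)) C)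
    (hsize : ∀ c ∈ C, c.card ≤ n - 1) :
    3 * n - 3 ≤ ∑ c ∈ C, c.card := by
  have hcount : ∑ c ∈ C, c.card = ∑ y, (C.filter (y ∈ ·)).card := by
    simpa [Finset.bipartiteAbove, Finset.bipartiteBelow] using
      (Finset.sum_card_bipartiteAbove_eq_sum_card_bipartiteBelow
        (s := Finset.univ) (t := C) (· ∈ ·)).symm
  rw [hcount]
  by_cases h : ∀ y, 3 ≤ (C.filter (y ∈ ·)).card
  · have := Finset.card_nsmul_le_sum Finset.univ _ 3 fun y _ => h y
    rw [Finset.card_univ, Fintype.card_fin, smul_eq_mul] at this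
    omega
  push Not at h
  obtain ⟨x, hx⟩ := h
  have hmem : ∀ {z}, x ≠ z → ∃ c ∈ C, x ∈ c ∧ z ∈ c ∧ 2 ≤ c.card := fun {z} hz => by
    obtain ⟨c, ⟨hcC, hxc, hzc⟩, -⟩ := hC.2 x z hz
    exact ⟨c, hcC, hxc, hzc, Finset.one_lt_card.2 ⟨x, hxc, z, hzc, hz⟩⟩
  have : Nontrivial (Fin n) := Fin.nontrivial_iff_two_le.2 (by omega)
  obtain ⟨z, hz⟩ := exists_ne x
  obtain ⟨a, haC, hxa, -, ha⟩ := hmem hz.symm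
  obtain ⟨w, hw⟩ : ∃ w, w ∉ a := by
    by_contra! hall
    have hcard := hsize a haC
    rw [Finset.eq_univ_iff_forall.2 hall, Finset.card_univ, Fintype.card_fin] at hcard
    omega
  obtain ⟨b, hbC, hxb, hwb, hb⟩ := hmem (z := w) (by rintro rfl; exact hw hxa)
  have hab : a ≠ b := by rintro rfl; exact hw hwb
  refine hC.sum_card_filter_mem_ge (x := x) hab ha hb (Finset.eq_of_subset_of_card_le ?_ ?_).symm
  · simp [Finset.insert_subset_iff, *]
  · rw [Finset.card_pair hab]
    omega
end

section
/- Let G be a simple graph on n vertices that is neither the empty graph nor the complete graph. Then scp(G) + scp(Ḡ) ≥ 3n − 3, and equality holds if and only if G or its complement Ḡ contains a clique of size n − 1 (i.e., a set of n − 1 pairwise adjacent vertices). -/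
theorem IsCliquePartition.eq_of_mem {V : Type*} {G : SimpleGraph V} {C : Finset (Finset V)}
    (hC : IsCliquePartition G C) {c d : Finset V} (hc : c ∈ C) (hd : d ∈ C) {x y : V}
    (hxy : x ≠ y) (hxc : x ∈ c) (hyc : y ∈ c) (hxd : x ∈ d) (hyd : y ∈ d) : c = d :=
  (hC.2 x y (hC.1 c hc hxc hyc hxy)).unique ⟨hc, hxc, hyc⟩ ⟨hd, hxd, hyd⟩

theorem IsCliquePartition.scp_le {V : Type*} [Fintype V] {G : SimpleGraph V}
    {C : Finset (Finset V)} (hC : IsCliquePartition G C) : scp G ≤ ∑ c ∈ C, c.card :=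
  Nat.sInf_le ⟨C, hC, rfl⟩

theorem exists_isCliquePartition {V : Type*} [Fintype V] (G : SimpleGraph V) :
    ∃ C : Finset (Finset V), IsCliquePartition G C := by
  classical
  refine ⟨Finset.univ.filter fun c => G.IsClique (c : Set V) ∧ c.card = 2, ?_, ?_⟩
  · intro c hc
    exact (Finset.mem_filter.1 hc).2.1
  · intro x y hxy
    refine ⟨{x, y}, ⟨?_, by simp, by simp⟩, ?_⟩
    · simp [hxy, Finset.card_pair hxy.ne]
    · rintro c ⟨hc, hx, hy⟩
      refine (Finset.eq_of_subset_of_card_le ?_ ?_).symm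
      · simp [Finset.insert_subset_iff, hx, hy]
      · rw [Finset.card_pair hxy.ne, (Finset.mem_filter.1 hc).2.2]

theorem exists_isCliquePartition_sum_eq_scp {V : Type*} [Fintype V] (G : SimpleGraph V) :
    ∃ C : Finset (Finset V), IsCliquePartition G C ∧ scp G = ∑ c ∈ C, c.card := by
  obtain ⟨C, hC⟩ := exists_isCliquePartition G
  exact Nat.sInf_mem (s := {s | ∃ C : Finset (Finset V), IsCliquePartition G C ∧
    s = ∑ c ∈ C, c.card}) ⟨_, C, hC, rfl⟩

theorem IsCliquePartition.union_compl {V : Type*} [DecidableEq V] {G : SimpleGraph V}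
    {C D : Finset (Finset V)} (hC : IsCliquePartition G C) (hD : IsCliquePartition Gᶜ D) :
    IsCliquePartition ⊤ (C ∪ D) := by
  refine ⟨fun c _ x _ y _ hxy => hxy, fun x y hxy => ?_⟩
  have hne : x ≠ y := hxy
  by_cases h : G.Adj x y
  · obtain ⟨c, ⟨hc, hx, hy⟩, hu⟩ := hC.2 x y h
    refine ⟨c, ⟨Finset.mem_union_left _ hc, hx, hy⟩, ?_⟩
    rintro d ⟨hd, hxd, hyd⟩
    rcases Finset.mem_union.1 hd with hd | hd
    · exact hu d ⟨hd, hxd, hyd⟩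
    · exact absurd h (hD.1 d hd hxd hyd hne).2
  · obtain ⟨c, ⟨hc, hx, hy⟩, hu⟩ := hD.2 x y ⟨hne, h⟩
    refine ⟨c, ⟨Finset.mem_union_right _ hc, hx, hy⟩, ?_⟩
    rintro d ⟨hd, hxd, hyd⟩
    rcases Finset.mem_union.1 hd with hd | hd
    · exact absurd (hC.1 d hd hxd hyd hne) h
    · exact hu d ⟨hd, hxd, hyd⟩

theorem sum_card_eq_sum_card_filter_mem {V : Type*} [Fintype V] [DecidableEq V]
    (F : Finset (Finset V)) :
    ∑ c ∈ F, c.card = ∑ x : V, (F.filter fun c => x ∈ c).card := by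
  simp_rw [Finset.card_eq_sum_ones, Finset.sum_filter]
  rw [Finset.sum_comm]
  simp

theorem two_le_card_filter_mem {V : Type*} [Fintype V] [DecidableEq V] [Nontrivial V]
    {F : Finset (Finset V)} (hF : IsCliquePartition ⊤ F) (huniv : Finset.univ ∉ F) (x : V) :
    2 ≤ (F.filter fun c => x ∈ c).card := by
  obtain ⟨y, hy⟩ := exists_ne x
  obtain ⟨c, ⟨hc, hxc, -⟩, -⟩ := hF.2 x y hy.symm
  obtain ⟨z, hz⟩ : ∃ z, z ∉ c := by
    by_contra! h
    exact huniv (Finset.eq_univ_iff_forall.2 h ▸ hc)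
  obtain ⟨d, ⟨hd, hxd, hzd⟩, -⟩ := hF.2 x z (by rintro rfl; exact hz hxc)
  refine Finset.one_lt_card.2 ⟨c, by simp [hc, hxc], d, by simp [hd, hxd], ?_⟩
  rintro rfl
  exact hz hzd

/-- A point has at least as many blocks through it as there are points on a block avoiding it. -/
theorem card_le_card_filter_mem {V : Type*} [DecidableEq V]
    {F : Finset (Finset V)} (hF : IsCliquePartition ⊤ F) {s : Finset V} (hs : s ∈ F) {v : V}
    (hv : v ∉ s) : s.card ≤ (F.filter fun c => v ∈ c).card := by
  have h : ∀ u ∈ s, ∃ c ∈ F, v ∈ c ∧ u ∈ c := fun u hu => by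
    obtain ⟨c, hc, -⟩ := hF.2 v u (by rintro rfl; exact hv hu)
    exact ⟨c, hc⟩
  choose! f hf hvf huf using h
  refine Finset.card_le_card_of_injOn f (fun u hu => by simp [hf u hu, hvf u hu]) ?_
  intro a ha b hb hab
  by_contra hne
  have hb' : b ∈ f a := by rw [hab]; exact huf b hb
  exact hv (hF.eq_of_mem (hf a ha) hs hne (huf a ha) hb' ha hb ▸ hvf a ha)

theorem three_le_card_filter_mem {V : Type*} [Fintype V] [DecidableEq V]
    {F : Finset (Finset V)} (hF : IsCliquePartition ⊤ F)
    (hcard : ∀ c ∈ F, c.card + 2 ≤ Fintype.card V) {x y : V} (hxy : x ≠ y)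
    (hx : (F.filter fun c => x ∈ c).card ≤ 2) : 3 ≤ (F.filter fun c => y ∈ c).card := by
  obtain ⟨a, ⟨ha, hxa, hya⟩, -⟩ := hF.2 x y hxy
  obtain ⟨z, w, hz, hw, hzw⟩ : ∃ z w, z ∉ a ∧ w ∉ a ∧ z ≠ w := by
    have h : 1 < aᶜ.card := by
      have := hcard a ha
      rw [Finset.card_compl]
      omega
    obtain ⟨z, hz, w, hw, hzw⟩ := Finset.one_lt_card.1 h
    exact ⟨z, w, Finset.mem_compl.1 hz, Finset.mem_compl.1 hw, hzw⟩
  obtain ⟨b, ⟨hb, hxb, hzb⟩, -⟩ := hF.2 x z (by rintro rfl; exact hz hxa)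
  obtain ⟨b', ⟨hb', hxb', hwb'⟩, -⟩ := hF.2 x w (by rintro rfl; exact hw hxa)
  have hab : a ≠ b := by rintro rfl; exact hz hzb
  have hab' : a ≠ b' := by rintro rfl; exact hw hwb'
  have hbb : b = b' := by
    by_contra hne
    have : 2 < (F.filter fun c => x ∈ c).card :=
      Finset.two_lt_card.2 ⟨a, by simp [ha, hxa], b, by simp [hb, hxb], b',
        by simp [hb', hxb'], hab, hab', hne⟩
    omega
  subst hbb
  obtain ⟨p, ⟨hp, hyp, hzp⟩, -⟩ := hF.2 y z (by rintro rfl; exact hz hya)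
  obtain ⟨q, ⟨hq, hyq, hwq⟩, -⟩ := hF.2 y w (by rintro rfl; exact hw hya)
  refine Finset.two_lt_card.2 ⟨a, by simp [ha, hya], p, by simp [hp, hyp], q,
    by simp [hq, hyq], ?_, ?_, ?_⟩
  · rintro rfl; exact hz hzp
  · rintro rfl; exact hw hwq
  · rintro rfl
    have hpb := hF.eq_of_mem hp hb hzw hzp hwq hzb hwb'
    subst hpb
    exact hab (hF.eq_of_mem ha hp hxy hxa hya hxb hyp)

theorem le_sum_card_of_card_add_one {V : Type*} [Fintype V] [DecidableEq V] [Nontrivial V]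
    {F : Finset (Finset V)} (hF : IsCliquePartition ⊤ F) (huniv : Finset.univ ∉ F)
    {s : Finset V} (hs : s ∈ F) (hcard : s.card + 1 = Fintype.card V) :
    3 * Fintype.card V ≤ ∑ c ∈ F, c.card + 3 := by
  obtain ⟨v, hv⟩ : ∃ v, v ∉ s := by
    by_contra! h
    exact huniv (Finset.eq_univ_iff_forall.2 h ▸ hs)
  rw [sum_card_eq_sum_card_filter_mem,
    ← Finset.add_sum_erase _ _ (Finset.mem_univ v)]
  have h1 := card_le_card_filter_mem hF hs hv
  have h2 := Finset.card_nsmul_le_sum (Finset.univ.erase v)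
    (fun x => (F.filter fun c => x ∈ c).card) 2
    fun x _ => two_le_card_filter_mem hF huniv x
  rw [Finset.card_erase_of_mem (Finset.mem_univ v), Finset.card_univ, smul_eq_mul] at h2
  omega

theorem lt_sum_card_of_card_add_two_le {V : Type*} [Fintype V] [DecidableEq V] [Nontrivial V]
    {F : Finset (Finset V)} (hF : IsCliquePartition ⊤ F) (huniv : Finset.univ ∉ F)
    (hcard : ∀ c ∈ F, c.card + 2 ≤ Fintype.card V) :
    3 * Fintype.card V < ∑ c ∈ F, c.card + 3 := by
  rw [sum_card_eq_sum_card_filter_mem]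
  obtain ⟨x, hx⟩ : ∃ x : V, ∀ y, y ≠ x → 3 ≤ (F.filter fun c => y ∈ c).card := by
    by_cases h : ∃ x : V, (F.filter fun c => x ∈ c).card ≤ 2
    · obtain ⟨x, hx⟩ := h
      exact ⟨x, fun y hy => three_le_card_filter_mem hF hcard hy.symm hx⟩
    · push Not at h
      exact ⟨Classical.arbitrary V, fun y _ => h y⟩
  rw [← Finset.add_sum_erase _ _ (Finset.mem_univ x)]
  have h1 := two_le_card_filter_mem hF huniv x
  have h2 := Finset.card_nsmul_le_sum (Finset.univ.erase x)
    (fun y => (F.filter fun c => y ∈ c).card) 3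
    fun y hy => hx y (Finset.ne_of_mem_erase hy)
  rw [Finset.card_erase_of_mem (Finset.mem_univ x), Finset.card_univ, smul_eq_mul] at h2
  omega

/-- If every edge of `G` lies inside the clique `s` or contains `v`, then `s` and the edges
at `v` form a clique partition. -/
theorem scp_le_card_add_two_mul_degree {V : Type*} [Fintype V] [DecidableEq V]
    (G : SimpleGraph V) [DecidableRel G.Adj] {s : Finset V} {v : V}
    (hs : G.IsClique (s : Set V)) (hv : v ∉ s)
    (h : ∀ x y, G.Adj x y → x ≠ v → y ≠ v → x ∈ s ∧ y ∈ s) :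
    scp G ≤ s.card + 2 * G.degree v := by
  have hC : IsCliquePartition G
      (insert s ((G.neighborFinset v).image fun u => ({v, u} : Finset V))) := by
    refine ⟨?_, ?_⟩
    · intro c hc
      rcases Finset.mem_insert.1 hc with rfl | hc
      · exact hs
      · obtain ⟨u, hu, rfl⟩ := Finset.mem_image.1 hc
        rw [SimpleGraph.mem_neighborFinset] at hu
        simp [hu]
    · intro x y hxy
      have hne := hxy.ne
      by_cases hxv : x = v
      · subst hxv
        refine ⟨{x, y}, ⟨?_, by simp, by simp⟩, ?_⟩
        · exact Finset.mem_insert_of_mem (Finset.mem_image.2 ⟨y, by simpa using hxy, rfl⟩)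
        · rintro c ⟨hc, hx, hy⟩
          rcases Finset.mem_insert.1 hc with rfl | hc
          · exact absurd hx hv
          · obtain ⟨u, hu, rfl⟩ := Finset.mem_image.1 hc
            grind
      by_cases hyv : y = v
      · subst hyv
        refine ⟨{y, x}, ⟨?_, by simp, by simp⟩, ?_⟩
        · exact Finset.mem_insert_of_mem (Finset.mem_image.2 ⟨x, by simpa using hxy.symm, rfl⟩)
        · rintro c ⟨hc, hx, hy⟩
          rcases Finset.mem_insert.1 hc with rfl | hc
          · exact absurd hy hv
          · obtain ⟨u, hu, rfl⟩ := Finset.mem_image.1 hc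
            grind
      · obtain ⟨hxs, hys⟩ := h x y hxy hxv hyv
        refine ⟨s, ⟨Finset.mem_insert_self _ _, hxs, hys⟩, ?_⟩
        rintro c ⟨hc, hx, hy⟩
        rcases Finset.mem_insert.1 hc with rfl | hc
        · rfl
        · obtain ⟨u, hu, rfl⟩ := Finset.mem_image.1 hc
          grind
  have hstar : ∑ c ∈ (G.neighborFinset v).image (fun u => ({v, u} : Finset V)), c.card ≤
      G.degree v * 2 := by
    refine (Finset.sum_le_card_nsmul _ _ 2 fun c hc => ?_).trans ?_
    · obtain ⟨u, -, rfl⟩ := Finset.mem_image.1 hc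
      exact Finset.card_le_two
    · rw [smul_eq_mul, ← G.card_neighborFinset_eq_degree]
      exact Nat.mul_le_mul_right _ Finset.card_image_le
  have hsum := hC.scp_le
  by_cases hmem : s ∈ (G.neighborFinset v).image fun u => ({v, u} : Finset V)
  · rw [Finset.insert_eq_of_mem hmem] at hsum
    omega
  · rw [Finset.sum_insert hmem] at hsum
    omega

theorem scp_add_scp_compl_le {V : Type*} [Fintype V] [DecidableEq V] (G : SimpleGraph V)
    {s : Finset V} (hs : G.IsClique (s : Set V)) (hcard : s.card + 1 = Fintype.card V) :
    scp G + scp Gᶜ ≤ 3 * Fintype.card V - 3 := by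
  classical
  obtain ⟨v, hv⟩ : ∃ v, sᶜ = {v} := by
    rw [← Finset.card_eq_one, Finset.card_compl]
    omega
  have hmem : ∀ x, x ∈ s ↔ x ≠ v := fun x => by
    rw [← not_iff_not, ← Finset.mem_compl, hv, Finset.mem_singleton, not_not]
  have h1 := scp_le_card_add_two_mul_degree G hs (v := v) (by simp [hmem])
    fun x y _ hx hy => ⟨(hmem x).2 hx, (hmem y).2 hy⟩
  have h2 := scp_le_card_add_two_mul_degree Gᶜ (s := ∅) (v := v) (by simp) (by simp)
    fun x y hxy hx hy => absurd (hs ((hmem x).2 hx) ((hmem y).2 hy) hxy.1) hxy.2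
  have h3 := G.degree_compl v
  have h4 := G.degree_lt_card_verts v
  rw [Finset.card_empty] at h2
  omega

theorem scp_add_scp_compl {V : Type*} [Fintype V] [DecidableEq V] (n : ℕ)
    (hn : Fintype.card V = n) (G : SimpleGraph V) (hG1 : G ≠ ⊥) (hG2 : G ≠ ⊤) :
    3 * n - 3 ≤ scp G + scp Gᶜ ∧
      (scp G + scp Gᶜ = 3 * n - 3 ↔
        ∃ s : Finset V, s.card = n - 1 ∧
          (G.IsClique (s : Set V) ∨ Gᶜ.IsClique (s : Set V))) := by
  subst hn
  obtain ⟨x, y, hxy⟩ := SimpleGraph.ne_bot_iff_exists_adj.1 hG1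
  have : Nontrivial V := ⟨x, y, hxy.ne⟩
  obtain ⟨C, hC, hCs⟩ := exists_isCliquePartition_sum_eq_scp G
  obtain ⟨D, hD, hDs⟩ := exists_isCliquePartition_sum_eq_scp Gᶜ
  have hF := hC.union_compl hD
  have hclique : ∀ c ∈ C ∪ D, G.IsClique (c : Set V) ∨ Gᶜ.IsClique (c : Set V) :=
    fun c hc => (Finset.mem_union.1 hc).imp (hC.1 c) (hD.1 c)
  have huniv : Finset.univ ∉ C ∪ D := fun h => by
    rcases hclique _ h with h | h
    · exact hG2 (eq_top_iff.2 fun a b hab => h (by simp) (by simp) hab)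
    · exact hG1 (compl_eq_top.1 (eq_top_iff.2 fun a b hab => h (by simp) (by simp) hab))
  have hsum : ∑ c ∈ C ∪ D, c.card ≤ scp G + scp Gᶜ := by
    rw [hCs, hDs, ← Finset.sum_union_inter]
    exact Nat.le_add_right _ _
  have hpos := Fintype.one_lt_card (α := V)
  have hcases : (∀ c ∈ C ∪ D, c.card + 2 ≤ Fintype.card V) ∨
      ∃ s ∈ C ∪ D, s.card + 1 = Fintype.card V := by
    by_contra! h
    obtain ⟨⟨c, hc, hlt⟩, h⟩ := h
    have hle := Finset.card_le_univ c
    have hcne : c.card ≠ Fintype.card V := fun hall =>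
      huniv (Finset.card_eq_iff_eq_univ c |>.1 hall ▸ hc)
    have := h c hc
    omega
  refine ⟨?_, ?_, ?_⟩
  · rcases hcases with h | ⟨s, hs, h⟩
    · have := lt_sum_card_of_card_add_two_le hF huniv h
      omega
    · have := le_sum_card_of_card_add_one hF huniv hs h
      omega
  · intro heq
    rcases hcases with h | ⟨s, hs, h⟩
    · have := lt_sum_card_of_card_add_two_le hF huniv h
      omega
    · exact ⟨s, by omega, hclique s hs⟩
  · rintro ⟨s, hs, hcl⟩
    have hle : scp G + scp Gᶜ ≤ 3 * Fintype.card V - 3 := by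
      rcases hcl with hcl | hcl
      · exact scp_add_scp_compl_le G hcl (by omega)
      · have := scp_add_scp_compl_le Gᶜ hcl (by omega)
        rwa [compl_compl, add_comm] at this
    refine hle.antisymm ?_
    rcases hcases with h | ⟨s, hs, h⟩
    · have := lt_sum_card_of_card_add_two_le hF huniv h
      omega
    · have := le_sum_card_of_card_add_one hF huniv hs h
      omega
end

section
/- Let (P, 𝓑) be a pairwise balanced design on n ≥ 2 points that contains a block of size κ. Then (n − 1) · Σ_{B ∈ 𝓑} |B| ≥ (n + 1)κ(n − 1) − κ²(κ − 1). -/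
namespace IsPBD

variable {α : Type*} [DecidableEq α] {P : Finset α} {B : Finset (Finset α)}

/-- A family of blocks covers each pair of distinct points at most once. -/
theorem sum_card_pairs_le (h : IsPBD P B) {M : Finset (Finset α)} (hM : M ⊆ B)
    (s : Finset (α × α)) (hs : ∀ p ∈ s, p.1 ≠ p.2) :
    ∑ b ∈ M, (s.filter fun p => p.1 ∈ b ∧ p.2 ∈ b).card ≤ s.card := by
  have key := Finset.sum_card_bipartiteAbove_eq_sum_card_bipartiteBelow (s := M) (t := s)
    (fun b p => p.1 ∈ b ∧ p.2 ∈ b)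
  simp only [Finset.bipartiteAbove, Finset.bipartiteBelow] at key
  rw [key, Finset.card_eq_sum_ones]
  refine Finset.sum_le_sum fun p hp => Finset.card_le_one.2 fun b hb c hc => ?_
  rw [Finset.mem_filter] at hb hc
  exact h.eq_of_mem (hM hb.1) (hM hc.1) (hs p hp) hb.2.1 hb.2.2 hc.2.1 hc.2.2

/-- A family of blocks that covers every pair in `s` counts each of them at least once. -/
theorem card_le_sum_card_pairs {M : Finset (Finset α)} (s : Finset (α × α))
    (hs : ∀ p ∈ s, ∃ b ∈ M, p.1 ∈ b ∧ p.2 ∈ b) :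
    s.card ≤ ∑ b ∈ M, (s.filter fun p => p.1 ∈ b ∧ p.2 ∈ b).card := by
  have key := Finset.sum_card_bipartiteAbove_eq_sum_card_bipartiteBelow (s := M) (t := s)
    (fun b p => p.1 ∈ b ∧ p.2 ∈ b)
  simp only [Finset.bipartiteAbove, Finset.bipartiteBelow] at key
  rw [key, Finset.card_eq_sum_ones]
  refine Finset.sum_le_sum fun p hp => Finset.card_pos.2 ?_
  obtain ⟨b, hb, hpb⟩ := hs p hp
  exact ⟨b, Finset.mem_filter.2 ⟨hb, hpb⟩⟩

/-- The blocks other than `A` that meet `A`. -/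
def meeting (B : Finset (Finset α)) (A : Finset α) : Finset (Finset α) :=
  (B.erase A).filter fun b => (b ∩ A).Nonempty

theorem mem_meeting {A b : Finset α} :
    b ∈ meeting B A ↔ (b ≠ A ∧ b ∈ B) ∧ (b ∩ A).Nonempty := by
  simp [meeting]

theorem meeting_subset (A : Finset α) : meeting B A ⊆ B :=
  fun _ hb => (mem_meeting.1 hb).1.2

theorem card_inter_of_mem_meeting (h : IsPBD P B) {A b : Finset α} (hA : A ∈ B)
    (hb : b ∈ meeting B A) : (b ∩ A).card = 1 := by
  obtain ⟨⟨hne, hbB⟩, hmeet⟩ := mem_meeting.1 hb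
  refine le_antisymm (Finset.card_le_one.2 fun x hx y hy => ?_) (Finset.card_pos.2 hmeet)
  rw [Finset.mem_inter] at hx hy
  by_contra hxy
  exact hne (h.eq_of_mem hbB hA hxy hx.1 hy.1 hx.2 hy.2)

theorem sum_card_sdiff_meeting (h : IsPBD P B) {A : Finset α} (hA : A ∈ B) :
    ∑ b ∈ meeting B A, (b \ A).card = A.card * (P \ A).card := by
  have hsum : ∑ b ∈ meeting B A, (b \ A).card =
      ∑ b ∈ meeting B A, ((A ×ˢ (P \ A)).filter fun p => p.1 ∈ b ∧ p.2 ∈ b).card := by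
    refine Finset.sum_congr rfl fun b hb => ?_
    have hbP := (h.1 b (meeting_subset A hb)).1
    have hprod : ((A ×ˢ (P \ A)).filter fun p => p.1 ∈ b ∧ p.2 ∈ b) = (b ∩ A) ×ˢ (b \ A) := by
      ext ⟨x, y⟩
      have := @hbP y
      simp only [Finset.mem_filter, Finset.mem_product, Finset.mem_sdiff, Finset.mem_inter]
      tauto
    rw [hprod, Finset.card_product, h.card_inter_of_mem_meeting hA hb, one_mul]
  have hne : ∀ p ∈ A ×ˢ (P \ A), p.1 ≠ p.2 := by
    intro p hp hxy
    rw [Finset.mem_product, Finset.mem_sdiff] at hp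
    exact hp.2.2 (hxy ▸ hp.1)
  rw [hsum, ← Finset.card_product]
  refine le_antisymm (h.sum_card_pairs_le (meeting_subset A) _ hne)
    (card_le_sum_card_pairs _ fun p hp => ?_)
  have hp' := hp
  rw [Finset.mem_product, Finset.mem_sdiff] at hp'
  obtain ⟨b, ⟨hb, hxb, hyb⟩, -⟩ := h.2 p.1 ((h.1 A hA).1 hp'.1) p.2 hp'.2.1 (hne p hp)
  refine ⟨b, mem_meeting.2 ⟨⟨?_, hb⟩, p.1, Finset.mem_inter.2 ⟨hxb, hp'.1⟩⟩, hxb, hyb⟩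
  rintro rfl
  exact hp'.2.2 hyb

theorem sum_card_offDiag_sdiff_le (h : IsPBD P B) {M : Finset (Finset α)} (hM : M ⊆ B)
    (A : Finset α) :
    ∑ b ∈ M, (b \ A).offDiag.card ≤ (P \ A).offDiag.card := by
  refine le_trans (Finset.sum_le_sum fun b hb => Finset.card_le_card fun p hp => ?_)
    (h.sum_card_pairs_le hM (P \ A).offDiag fun p hp => (Finset.mem_offDiag.1 hp).2.2)
  have hbP := (h.1 b (hM hb)).1
  simp only [Finset.mem_offDiag, Finset.mem_sdiff, Finset.mem_filter] at hp ⊢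
  exact ⟨⟨⟨hbP hp.1.1, hp.1.2⟩, ⟨hbP hp.2.1.1, hp.2.1.2⟩, hp.2.2⟩, hp.1.1, hp.2.1.1⟩

theorem card_add_sum_meeting_le (h : IsPBD P B) {A : Finset α} (hA : A ∈ B) :
    A.card + ((meeting B A).card + ∑ b ∈ meeting B A, (b \ A).card) ≤ ∑ b ∈ B, b.card := by
  rw [← Finset.add_sum_erase B _ hA, Finset.card_eq_sum_ones (meeting B A),
    ← Finset.sum_add_distrib]
  refine Nat.add_le_add_left (le_trans (le_of_eq (Finset.sum_congr rfl fun b hb => ?_))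
    (Finset.sum_le_sum_of_subset (Finset.filter_subset _ _))) _
  have := Finset.card_inter_add_card_sdiff b A
  have := h.card_inter_of_mem_meeting hA hb
  omega

end IsPBD

theorem pbd_sum_ge_of_block_size {α : Type*} [DecidableEq α] (n κ : ℕ) (hn : 2 ≤ n)
    (P : Finset α) (B : Finset (Finset α)) (hP : P.card = n)
    (h : IsPBD P B) (hκ : ∃ b ∈ B, b.card = κ) :
    ((n : ℤ) + 1) * κ * ((n : ℤ) - 1) - (κ : ℤ) ^ 2 * ((κ : ℤ) - 1) ≤
      ((n : ℤ) - 1) * ∑ b ∈ B, (b.card : ℤ) := by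
  obtain ⟨A, hA, rfl⟩ := hκ
  set M := IsPBD.meeting B A
  have hS : (A.card : ℤ) + (M.card + ∑ b ∈ M, ((b \ A).card : ℤ)) ≤ ∑ b ∈ B, (b.card : ℤ) := by
    exact_mod_cast h.card_add_sum_meeting_le hA
  have hm : ((P \ A).card : ℤ) = n - A.card := by
    have := Finset.card_sdiff_add_card_eq_card (h.1 A hA).1
    omega
  have hT : ∑ b ∈ M, ((b \ A).card : ℤ) = A.card * (n - A.card) := by
    rw [← hm]
    exact_mod_cast h.sum_card_sdiff_meeting hA
  have hoff : ∀ s : Finset α, (s.offDiag.card : ℤ) = (s.card : ℤ) ^ 2 - s.card := fun s => by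
    rw [Finset.offDiag_card, Nat.cast_sub (Nat.le_mul_self _), Nat.cast_mul, sq]
  have hQ : ∑ b ∈ M, ((b \ A).card : ℤ) ^ 2 ≤ (n - A.card) * (n - 1) := by
    have hle : ∑ b ∈ M, ((b \ A).offDiag.card : ℤ) ≤ ((P \ A).offDiag.card : ℤ) := by
      exact_mod_cast h.sum_card_offDiag_sdiff_le (IsPBD.meeting_subset A) A
    simp only [hoff, Finset.sum_sub_distrib, hT, hm] at hle
    linarith
  have hsq : 0 ≤ ∑ b ∈ M, ((A.card : ℤ) * (b \ A).card - (n - 1)) ^ 2 :=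
    Finset.sum_nonneg fun b _ => sq_nonneg _
  have hexp : ∑ b ∈ M, ((A.card : ℤ) * (b \ A).card - (n - 1)) ^ 2 =
      (A.card : ℤ) ^ 2 * ∑ b ∈ M, ((b \ A).card : ℤ) ^ 2
        - 2 * A.card * (n - 1) * ∑ b ∈ M, ((b \ A).card : ℤ) + M.card * ((n : ℤ) - 1) ^ 2 := by
    rw [Finset.mul_sum, Finset.mul_sum, ← Finset.sum_sub_distrib, ← nsmul_eq_mul,
      ← Finset.sum_const, ← Finset.sum_add_distrib]
    exact Finset.sum_congr rfl fun b _ => by ring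
  have hN : (0 : ℤ) < n - 1 := by omega
  have hD : (A.card : ℤ) ^ 2 * (n - A.card) ≤ ((n : ℤ) - 1) * M.card := by
    refine le_of_mul_le_mul_left ?_ hN
    rw [hexp, hT] at hsq
    nlinarith [mul_le_mul_of_nonneg_left hQ (sq_nonneg (A.card : ℤ))]
  rw [hT] at hS
  nlinarith [mul_le_mul_of_nonneg_left hS hN.le]
end

section
/- Let (P, 𝓑) be a pairwise balanced design on n points that contains a block of size κ. Then, as integers, 2 · Σ_{B ∈ 𝓑} |B| ≥ 2κ − (n − κ)(n − 5κ − 1). -/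
/-- Every set of ordered pairs of distinct points is partitioned by the blocks containing them. -/
theorem IsPBD.sum_card_filter_pairs {α : Type*} [DecidableEq α] {P : Finset α}
    {B : Finset (Finset α)} (h : IsPBD P B) (T : Finset (α × α))
    (hT : ∀ p ∈ T, p.1 ∈ P ∧ p.2 ∈ P ∧ p.1 ≠ p.2) :
    ∑ b ∈ B, (T.filter fun p => p.1 ∈ b ∧ p.2 ∈ b).card = T.card := by
  have key := Finset.sum_card_bipartiteAbove_eq_sum_card_bipartiteBelow
    (s := B) (t := T) (fun b p => p.1 ∈ b ∧ p.2 ∈ b)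
  simp only [Finset.bipartiteAbove, Finset.bipartiteBelow] at key
  rw [key, Finset.card_eq_sum_ones]
  refine Finset.sum_congr rfl fun p hp => ?_
  obtain ⟨h1, h2, hne⟩ := hT p hp
  obtain ⟨b, hb, huniq⟩ := h.2 p.1 h1 p.2 h2 hne
  rw [Finset.card_eq_one]
  refine ⟨b, ?_⟩
  ext c
  simp only [Finset.mem_filter, Finset.mem_singleton]
  exact ⟨fun hc => huniq c hc, fun hc => hc ▸ hb⟩

/-- Distinct blocks meet in at most one point. -/
theorem IsPBD.card_inter_le_one {α : Type*} [DecidableEq α] {P : Finset α}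
    {B : Finset (Finset α)} (h : IsPBD P B) {b c : Finset α} (hb : b ∈ B) (hc : c ∈ B)
    (hbc : b ≠ c) : (b ∩ c).card ≤ 1 := by
  rw [Finset.card_le_one]
  intro x hx y hy
  by_contra hxy
  rw [Finset.mem_inter] at hx hy
  exact hbc ((h.2 x ((h.1 b hb).1 hx.1) y ((h.1 b hb).1 hy.1) hxy).unique
    ⟨hb, hx.1, hy.1⟩ ⟨hc, hx.2, hy.2⟩)

/-- The pairs inside `S` are partitioned by the blocks. -/
theorem IsPBD.sum_card_inter_mul_pred {α : Type*} [DecidableEq α] {P : Finset α}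
    {B : Finset (Finset α)} (h : IsPBD P B) {S : Finset α} (hS : S ⊆ P) :
    ∑ b ∈ B, ((b ∩ S).card : ℤ) * ((b ∩ S).card - 1) = (S.card : ℤ) * (S.card - 1) := by
  have hoff (s : Finset α) : (s.offDiag.card : ℤ) = (s.card : ℤ) * (s.card - 1) := by
    rw [Finset.offDiag_card, Nat.cast_sub (Nat.le_mul_self _)]
    push_cast
    ring
  rw [← hoff, ← h.sum_card_filter_pairs S.offDiag fun p hp => by
    rw [Finset.mem_offDiag] at hp
    exact ⟨hS hp.1, hS hp.2.1, hp.2.2⟩, Nat.cast_sum]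
  refine Finset.sum_congr rfl fun b _ => ?_
  rw [← hoff]
  congr 2
  ext p
  simp only [Finset.mem_offDiag, Finset.mem_filter, Finset.mem_inter]
  tauto

/-- The pairs between disjoint sets `S` and `T` are partitioned by the blocks. -/
theorem IsPBD.sum_card_inter_mul_card_inter {α : Type*} [DecidableEq α] {P : Finset α}
    {B : Finset (Finset α)} (h : IsPBD P B) {S T : Finset α} (hS : S ⊆ P) (hT : T ⊆ P)
    (hST : Disjoint S T) :
    ∑ b ∈ B, (b ∩ S).card * (b ∩ T).card = S.card * T.card := by
  rw [← Finset.card_product, ← h.sum_card_filter_pairs (S ×ˢ T) fun p hp => by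
    rw [Finset.mem_product] at hp
    exact ⟨hS hp.1, hT hp.2, fun he => Finset.disjoint_left.1 hST hp.1 (he ▸ hp.2)⟩]
  refine Finset.sum_congr rfl fun b _ => ?_
  rw [← Finset.card_product]
  congr 1
  ext p
  simp only [Finset.mem_product, Finset.mem_filter, Finset.mem_inter]
  tauto

theorem pbd_sum_ge_of_block_size' {α : Type*} [DecidableEq α] (n κ : ℕ)
    (P : Finset α) (B : Finset (Finset α)) (hP : P.card = n)
    (h : IsPBD P B) (hκ : ∃ b ∈ B, b.card = κ) :
    2 * (κ : ℤ) - ((n : ℤ) - κ) * ((n : ℤ) - 5 * κ - 1) ≤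
      2 * ∑ b ∈ B, (b.card : ℤ) := by
  obtain ⟨K, hK, rfl⟩ := hκ
  have hKP : K ⊆ P := (h.1 K hK).1
  have hm : ((P \ K).card : ℤ) = n - K.card := by
    rw [Finset.card_sdiff_of_subset hKP, Nat.cast_sub (Finset.card_le_card hKP), hP]
  have inside := h.sum_card_inter_mul_pred (Finset.sdiff_subset (s := P) (t := K))
  have across : ∑ b ∈ B, ((b ∩ K).card : ℤ) * (b ∩ (P \ K)).card
      = (K.card : ℤ) * (P \ K).card := by
    exact_mod_cast h.sum_card_inter_mul_card_inter hKP Finset.sdiff_subset Finset.disjoint_sdiff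
  have block : ∀ b ∈ B, (if b = K then 2 * (K.card : ℤ) else 0)
      + 4 * (((b ∩ K).card : ℤ) * (b ∩ (P \ K)).card)
      - ((b ∩ (P \ K)).card : ℤ) * ((b ∩ (P \ K)).card - 1) ≤ 2 * (b.card : ℤ) := by
    intro b hb
    by_cases hbK : b = K
    · subst hbK
      simp
    · have hcard : (b.card : ℤ) = (b ∩ K).card + (b ∩ (P \ K)).card := by
        have hsplit : b ∩ (P \ K) = b \ K := by
          rw [← Finset.inter_sdiff_assoc, Finset.inter_eq_left.2 (h.1 b hb).1]
        rw [hsplit]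
        exact_mod_cast (Finset.card_inter_add_card_sdiff b K).symm
      have hk := h.card_inter_le_one hb hK hbK
      rw [if_neg hbK, hcard]
      generalize (b ∩ K).card = k at *
      generalize (b ∩ (P \ K)).card = t at *
      interval_cases k
      · push_cast
        nlinarith [sq_nonneg (t : ℤ)]
      · have : 0 ≤ ((t : ℤ) - 1) * (t - 2) := by
          rcases le_or_gt t 1 with ht | ht
          · exact mul_nonneg_of_nonpos_of_nonpos (by omega) (by omega)
          · exact mul_nonneg (by omega) (by omega)
        push_cast
        linarith
  have total := Finset.sum_le_sum block
  rw [Finset.sum_sub_distrib, Finset.sum_add_distrib, Finset.sum_ite_eq' B K, if_pos hK,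
    ← Finset.mul_sum, ← Finset.mul_sum, inside, across, hm] at total
  linarith
end

section
/- Let n and κ be integers with 2 ≤ κ ≤ n and 2κ ≥ n. Then there exists a pairwise balanced design (P, 𝓑) on n points containing a block of size κ such that, as integers, 2 · Σ_{B ∈ 𝓑} |B| = 2κ − (n − κ)(n − 5κ − 1). -/
/-- Addition modulo `m`, for arguments smaller than `m`. -/
def cyclicAdd (m i j : ℕ) : ℕ := if i + j < m then i + j else i + j - m

/-- The block through the points `κ + i` and `κ + j`, completed by the point `i + j` modulo `m`. -/
def colourBlock (κ m i j : ℕ) : Finset ℕ := {cyclicAdd m i j, κ + i, κ + j}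

/-- The blocks on `κ + m` points given by the block `{0, …, κ - 1}`, the blocks coming from the
colouring of the complete graph on the other `m` points by addition modulo `m`, and the pairs
joining one of these points to an unused colour. -/
def cyclicDesign (κ m : ℕ) : Finset (Finset ℕ) :=
  {Finset.range κ} ∪
    (((Finset.range m).sigma fun j => Finset.range (j + 1)).image
      fun p => colourBlock κ m p.2 p.1) ∪
    ((Finset.Ico m κ ×ˢ Finset.range m).image fun p => {p.1, κ + p.2})

theorem cyclicAdd_lt {m i j : ℕ} (hi : i < m) (hj : j < m) : cyclicAdd m i j < m := by
  unfold cyclicAdd; split_ifs <;> omega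

theorem cyclicAdd_comm (m i j : ℕ) : cyclicAdd m i j = cyclicAdd m j i := by
  simp only [cyclicAdd, add_comm]

theorem cyclicAdd_left_injective {m i i' j : ℕ} (hi : i < m) (hi' : i' < m)
    (h : cyclicAdd m i j = cyclicAdd m i' j) : i = i' := by
  unfold cyclicAdd at h; split_ifs at h <;> omega

theorem exists_cyclicAdd_eq {m x j : ℕ} (hx : x < m) (hj : j < m) :
    ∃ i < m, cyclicAdd m i j = x := by
  refine ⟨if j ≤ x then x - j else x + m - j, by split_ifs <;> omega, ?_⟩
  rw [cyclicAdd]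
  grind

theorem colourBlock_comm (κ m i j : ℕ) : colourBlock κ m i j = colourBlock κ m j i := by
  simp only [colourBlock, cyclicAdd_comm m i j, Finset.pair_comm (κ + i)]

theorem mem_cyclicDesign {κ m : ℕ} {b : Finset ℕ} :
    b ∈ cyclicDesign κ m ↔ b = Finset.range κ ∨
      (∃ i < m, ∃ j < m, b = colourBlock κ m i j) ∨
      ∃ k, m ≤ k ∧ k < κ ∧ ∃ j < m, b = {k, κ + j} := by
  simp only [cyclicDesign, Finset.mem_union, Finset.mem_singleton, Finset.mem_image,
    Finset.mem_sigma, Finset.mem_product, Finset.mem_range, Finset.mem_Ico, Sigma.exists,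
    Prod.exists, or_assoc]
  refine or_congr Iff.rfl (or_congr ⟨?_, ?_⟩ ⟨?_, ?_⟩)
  · rintro ⟨j, i, ⟨hj, hi⟩, rfl⟩
    exact ⟨i, by omega, j, hj, rfl⟩
  · rintro ⟨i, hi, j, hj, rfl⟩
    rcases le_total i j with h | h
    · exact ⟨j, i, ⟨hj, by omega⟩, rfl⟩
    · exact ⟨i, j, ⟨hi, by omega⟩, colourBlock_comm κ m j i⟩
  · rintro ⟨k, j, ⟨⟨hk, hk'⟩, hj⟩, rfl⟩
    exact ⟨k, hk, hk', j, hj, rfl⟩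
  · rintro ⟨k, hk, hk', j, hj, rfl⟩
    exact ⟨k, j, ⟨⟨hk, hk'⟩, hj⟩, rfl⟩

theorem card_colourBlock {κ m i j : ℕ} (hm : m ≤ κ) (hi : i < m) (hj : j < m) :
    (colourBlock κ m i j).card = if i = j then 2 else 3 := by
  have := cyclicAdd_lt hi hj
  unfold colourBlock
  split_ifs with h
  · subst h
    rw [Finset.pair_eq_singleton, Finset.card_pair (by omega)]
  · exact Finset.card_eq_three.2 ⟨_, _, _, by omega, by omega, by omega, rfl⟩

theorem existsUnique_mem_cyclicDesign {κ m x y : ℕ} (hm : m ≤ κ) (hxy : x < y)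
    (hy : y < κ + m) : ∃! b, b ∈ cyclicDesign κ m ∧ x ∈ b ∧ y ∈ b := by
  simp only [mem_cyclicDesign]
  by_cases hyκ : y < κ
  · refine ⟨Finset.range κ, ⟨Or.inl rfl, by simp; omega, by simp; omega⟩, ?_⟩
    rintro b ⟨rfl | ⟨i, hi, j, hj, rfl⟩ | ⟨k, hk, hk', j, hj, rfl⟩, hxb, hyb⟩
    · rfl
    all_goals
      simp only [colourBlock, Finset.mem_insert, Finset.mem_singleton] at hxb hyb
      omega
  obtain ⟨j, rfl⟩ := Nat.exists_eq_add_of_le (not_lt.1 hyκ)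
  have hj : j < m := by omega
  by_cases hxκ : x < κ
  · by_cases hxm : x < m
    · obtain ⟨i, hi, rfl⟩ := exists_cyclicAdd_eq hxm hj
      refine ⟨colourBlock κ m i j, ⟨Or.inr (Or.inl ⟨i, hi, j, hj, rfl⟩), by simp [colourBlock],
        by simp [colourBlock]⟩, ?_⟩
      rintro b ⟨rfl | ⟨i', hi', j', hj', rfl⟩ | ⟨k, hk, hk', j', hj', rfl⟩, hxb, hyb⟩
      · simp at hyb
      · have hc := cyclicAdd_lt hi' hj'
        simp only [colourBlock, Finset.mem_insert, Finset.mem_singleton] at hxb hyb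
        have hx : cyclicAdd m i j = cyclicAdd m i' j' := by omega
        obtain rfl | rfl : j = i' ∨ j = j' := by omega
        · rw [cyclicAdd_comm m j] at hx
          rw [cyclicAdd_left_injective hi hj' hx, colourBlock_comm]
        · rw [cyclicAdd_left_injective hi hi' hx]
      · simp only [Finset.mem_insert, Finset.mem_singleton] at hxb hyb
        omega
    · refine ⟨{x, κ + j}, ⟨Or.inr (Or.inr ⟨x, not_lt.1 hxm, hxκ, j, hj, rfl⟩), by simp,
        by simp⟩, ?_⟩
      rintro b ⟨rfl | ⟨i', hi', j', hj', rfl⟩ | ⟨k, hk, hk', j', hj', rfl⟩, hxb, hyb⟩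
      · simp at hyb
      · have hc := cyclicAdd_lt hi' hj'
        simp only [colourBlock, Finset.mem_insert, Finset.mem_singleton] at hxb hyb
        omega
      · simp only [Finset.mem_insert, Finset.mem_singleton] at hxb hyb
        obtain rfl : x = k := by omega
        obtain rfl : j = j' := by omega
        rfl
  · obtain ⟨i, rfl⟩ := Nat.exists_eq_add_of_le (not_lt.1 hxκ)
    have hi : i < m := by omega
    refine ⟨colourBlock κ m i j, ⟨Or.inr (Or.inl ⟨i, hi, j, hj, rfl⟩), by simp [colourBlock],
      by simp [colourBlock]⟩, ?_⟩
    rintro b ⟨rfl | ⟨i', hi', j', hj', rfl⟩ | ⟨k, hk, hk', j', hj', rfl⟩, hxb, hyb⟩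
    · simp at hyb
    · have hc := cyclicAdd_lt hi' hj'
      simp only [colourBlock, Finset.mem_insert, Finset.mem_singleton] at hxb hyb
      obtain ⟨rfl, rfl⟩ | ⟨rfl, rfl⟩ : (i = i' ∧ j = j') ∨ (i = j' ∧ j = i') := by omega
      · rfl
      · exact colourBlock_comm κ m j i
    · simp only [Finset.mem_insert, Finset.mem_singleton] at hxb hyb
      omega

theorem isPBD_cyclicDesign {κ m : ℕ} (hκ : 2 ≤ κ) (hm : m ≤ κ) :
    IsPBD (Finset.range (κ + m)) (cyclicDesign κ m) := by
  refine ⟨fun b hb => ?_, fun x hx y hy hxy => ?_⟩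
  · obtain rfl | ⟨i, hi, j, hj, rfl⟩ | ⟨k, hk, hk', j, hj, rfl⟩ := mem_cyclicDesign.1 hb
    · exact ⟨Finset.range_subset_range.2 (by omega), by simpa⟩
    · have hc := cyclicAdd_lt hi hj
      refine ⟨fun z hz => ?_, by rw [card_colourBlock hm hi hj]; split_ifs <;> omega⟩
      simp only [colourBlock, Finset.mem_insert, Finset.mem_singleton] at hz
      rw [Finset.mem_range]
      omega
    · refine ⟨fun z hz => ?_, by rw [Finset.card_pair (by omega)]⟩
      simp only [Finset.mem_insert, Finset.mem_singleton] at hz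
      rw [Finset.mem_range]
      omega
  · rw [Finset.mem_range] at hx hy
    rcases lt_or_gt_of_ne hxy with h | h
    · exact existsUnique_mem_cyclicDesign hm h hy
    · simpa only [and_comm (a := x ∈ _)] using existsUnique_mem_cyclicDesign hm h hx

theorem two_mul_sum_card_colourBlock {κ m : ℕ} (hm : m ≤ κ) :
    2 * ∑ p ∈ (Finset.range m).sigma fun j => Finset.range (j + 1),
      ((colourBlock κ m p.2 p.1).card : ℤ) = 3 * m ^ 2 + m := by
  have hrow : ∀ j ∈ Finset.range m,
      ∑ i ∈ Finset.range (j + 1), ((colourBlock κ m i j).card : ℤ) = 3 * j + 2 := by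
    intro j hj
    rw [Finset.mem_range] at hj
    have hlt : ∀ i ∈ Finset.range j, ((colourBlock κ m i j).card : ℤ) = 3 := by
      intro i hi
      rw [Finset.mem_range] at hi
      rw [card_colourBlock hm (hi.trans hj) hj, if_neg hi.ne]
      rfl
    rw [Finset.sum_range_succ, Finset.sum_congr rfl hlt, card_colourBlock hm hj hj]
    simp [mul_comm]
  rw [Finset.sum_sigma, Finset.sum_congr rfl hrow]
  clear hrow hm
  induction m with
  | zero => simp
  | succ m ih =>
    rw [Finset.sum_range_succ, mul_add, ih]
    push_cast
    ring

theorem two_mul_sum_card_cyclicDesign {κ m : ℕ} (hm : m ≤ κ) :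
    2 * ∑ b ∈ cyclicDesign κ m, (b.card : ℤ) = 2 * κ + (3 * m ^ 2 + m) + 4 * (κ - m) * m := by
  have hcolour : Set.InjOn (fun p : (_ : ℕ) × ℕ => colourBlock κ m p.2 p.1)
      ((Finset.range m).sigma fun j => Finset.range (j + 1)) := by
    rintro ⟨j, i⟩ h ⟨j', i'⟩ h' heq
    simp only [Finset.coe_sigma, Set.mem_sigma_iff, Finset.coe_range, Set.mem_Iio] at h h'
    have hc := cyclicAdd_lt (m := m) (i := i) (j := j) (by omega) h.1
    have hc' := cyclicAdd_lt (m := m) (i := i') (j := j') (by omega) h'.1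
    have hmem := fun z => Finset.ext_iff.1 heq z
    simp only [colourBlock, Finset.mem_insert, Finset.mem_singleton] at hmem
    have h₁ := hmem (κ + i)
    have h₂ := hmem (κ + j)
    have h₃ := hmem (κ + i')
    have h₄ := hmem (κ + j')
    obtain rfl : j = j' := by omega
    obtain rfl : i = i' := by omega
    rfl
  have hpair : Set.InjOn (fun p : ℕ × ℕ => ({p.1, κ + p.2} : Finset ℕ))
      (Finset.Ico m κ ×ˢ Finset.range m : Finset (ℕ × ℕ)) := by
    rintro ⟨k, j⟩ h ⟨k', j'⟩ h' heq
    simp only [Finset.mem_coe, Finset.mem_product, Finset.mem_Ico, Finset.mem_range] at h h'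
    have hmem := fun z => Finset.ext_iff.1 heq z
    simp only [Finset.mem_insert, Finset.mem_singleton] at hmem
    have h₁ := hmem k
    have h₂ := hmem (κ + j)
    rw [Prod.mk.injEq]
    omega
  have hdisj : Disjoint {Finset.range κ}
      (((Finset.range m).sigma fun j => Finset.range (j + 1)).image
        fun p => colourBlock κ m p.2 p.1) := by
    rw [Finset.disjoint_singleton_left, Finset.mem_image]
    rintro ⟨⟨j, i⟩, -, heq⟩
    have := Finset.ext_iff.1 heq (κ + j)
    simp [colourBlock] at this
  have hdisj' : Disjoint ({Finset.range κ} ∪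
      (((Finset.range m).sigma fun j => Finset.range (j + 1)).image
        fun p => colourBlock κ m p.2 p.1))
      ((Finset.Ico m κ ×ˢ Finset.range m).image fun p => {p.1, κ + p.2}) := by
    rw [Finset.disjoint_right]
    intro b hb hb'
    obtain ⟨⟨k, l⟩, h, rfl⟩ := Finset.mem_image.1 hb
    simp only [Finset.mem_product, Finset.mem_Ico, Finset.mem_range] at h
    rcases Finset.mem_union.1 hb' with heq | hb'
    · have := Finset.ext_iff.1 (Finset.mem_singleton.1 heq) (κ + l)
      simp at this
    · obtain ⟨⟨j, i⟩, h', heq⟩ := Finset.mem_image.1 hb'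
      simp only [Finset.mem_sigma, Finset.mem_range] at h'
      have hc := cyclicAdd_lt (m := m) (i := i) (j := j) (by omega) h'.1
      have := Finset.ext_iff.1 heq k
      simp only [colourBlock, Finset.mem_insert, Finset.mem_singleton, true_or, iff_true] at this
      omega
  have hcard : ∀ p ∈ Finset.Ico m κ ×ˢ Finset.range m,
      ((({p.1, κ + p.2} : Finset ℕ).card : ℕ) : ℤ) = 2 := by
    intro p hp
    simp only [Finset.mem_product, Finset.mem_Ico, Finset.mem_range] at hp
    rw [Finset.card_pair (by omega)]
    rfl
  rw [cyclicDesign, Finset.sum_union hdisj', Finset.sum_union hdisj, Finset.sum_image hcolour,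
    Finset.sum_image hpair, Finset.sum_congr rfl hcard, mul_add, mul_add,
    two_mul_sum_card_colourBlock hm]
  simp only [Finset.sum_singleton, Finset.card_range, Finset.sum_const, Finset.card_product,
    Nat.card_Ico, nsmul_eq_mul, Nat.cast_mul, Nat.cast_sub hm]
  ring

theorem exists_pbd_sum_eq (n κ : ℕ) (h1 : 2 ≤ κ) (h2 : κ ≤ n) (h3 : n ≤ 2 * κ) :
    ∃ (P : Finset ℕ) (B : Finset (Finset ℕ)), P.card = n ∧ IsPBD P B ∧
      (∃ b ∈ B, b.card = κ) ∧
      2 * ∑ b ∈ B, (b.card : ℤ) =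
        2 * (κ : ℤ) - ((n : ℤ) - κ) * ((n : ℤ) - 5 * κ - 1) := by
  obtain ⟨m, rfl⟩ := Nat.exists_eq_add_of_le h2
  have hm : m ≤ κ := by omega
  refine ⟨Finset.range (κ + m), cyclicDesign κ m, Finset.card_range _, isPBD_cyclicDesign h1 hm,
    ⟨Finset.range κ, mem_cyclicDesign.2 (Or.inl rfl), Finset.card_range κ⟩, ?_⟩
  rw [two_mul_sum_card_cyclicDesign hm]
  push_cast
  ring
end

section
/- Let q ≥ 3 be an integer and suppose there exists a resolvable (q², q, 1)-design. Then there exists a pairwise balanced design (P, 𝓑) on n = q² + 1 points in which every block has size at most q + 1 and Σ_{B ∈ 𝓑} |B| = q³ + q² + q = n(⌊√n⌋ + 1) − 1. -/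
/-- A resolvable `(v, k, 1)`-design: a PBD on `v` points all of whose blocks have
size `k`, whose block family can be partitioned into parallel classes, each of
which is a partition of the point set. -/
def IsResolvableDesign {α : Type*} [DecidableEq α] (P : Finset α)
    (B : Finset (Finset α)) (v k : ℕ) : Prop :=
  P.card = v ∧ IsPBD P B ∧ (∀ b ∈ B, b.card = k) ∧
    ∃ (I : Finset ℕ) (cls : ℕ → Finset (Finset α)),
      (∀ i ∈ I, cls i ⊆ B ∧ ∀ x ∈ P, ∃! b, b ∈ cls i ∧ x ∈ b) ∧
      ∀ b ∈ B, ∃! i, i ∈ I ∧ b ∈ cls i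

/-- If every point of `P` lies in exactly `n` members of `B`, all of them subsets of `P`,
then the sizes of the members of `B` add up to `P.card * n`. -/
theorem sum_card_eq_card_mul {α : Type*} [DecidableEq α] {P : Finset α}
    {B : Finset (Finset α)} {n : ℕ} (hB : ∀ b ∈ B, b ⊆ P)
    (hn : ∀ x ∈ P, (B.filter (x ∈ ·)).card = n) : ∑ b ∈ B, b.card = P.card * n := by
  rw [← Finset.sum_card_inter hn]
  refine Finset.sum_congr rfl fun b hb => ?_
  rw [Finset.inter_eq_right.2 (hB b hb)]

/-- A double count of the pairs through `x` in a PBD all of whose blocks have size `k`. -/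
theorem IsPBD.card_blocks_through_mul {α : Type*} [DecidableEq α] {P : Finset α}
    {B : Finset (Finset α)} {k : ℕ} (h : IsPBD P B) (hk : ∀ b ∈ B, b.card = k)
    {x : α} (hx : x ∈ P) : (B.filter (x ∈ ·)).card * (k - 1) = P.card - 1 := by
  have key : ∀ y ∈ P.erase x, ((B.filter (x ∈ ·)).filter (y ∈ ·)).card = 1 := by
    intro y hy
    rw [Finset.mem_erase] at hy
    obtain ⟨b, hb, hu⟩ := h.2 x hx y hy.2 hy.1.symm
    refine Finset.card_eq_one.2 ⟨b, ?_⟩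
    ext c
    simp only [Finset.mem_filter, Finset.mem_singleton]
    exact ⟨fun hc => hu c ⟨hc.1.1, hc.1.2, hc.2⟩,
      fun hc => hc ▸ ⟨⟨hb.1, hb.2.1⟩, hb.2.2⟩⟩
  have hs := Finset.sum_card_inter key
  rw [mul_one, Finset.card_erase_of_mem hx] at hs
  rw [← hs, ← smul_eq_mul, ← Finset.sum_const]
  refine Finset.sum_congr rfl fun b hb => ?_
  rw [Finset.mem_filter] at hb
  rw [Finset.erase_inter, Finset.inter_eq_right.2 (h.1 b hb.1).1,
    Finset.card_erase_of_mem hb.2, hk b hb.1]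

/-- Adjoin the point `p` to those blocks that belong to `C`. -/
def adjoinOn {α : Type*} [DecidableEq α] (p : α) (C : Finset (Finset α))
    (b : Finset α) : Finset α :=
  if b ∈ C then insert p b else b

theorem mem_adjoinOn {α : Type*} [DecidableEq α] {p x : α} {C : Finset (Finset α)}
    {b : Finset α} : x ∈ adjoinOn p C b ↔ x = p ∧ b ∈ C ∨ x ∈ b := by
  unfold adjoinOn
  split_ifs with h <;> simp [h]

theorem card_adjoinOn {α : Type*} [DecidableEq α] {p : α} {C : Finset (Finset α)}
    {b : Finset α} (hp : p ∉ b) :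
    (adjoinOn p C b).card = b.card + if b ∈ C then 1 else 0 := by
  unfold adjoinOn
  split_ifs with h <;> simp [hp]

theorem adjoinOn_injOn {α : Type*} [DecidableEq α] {p : α} {B C : Finset (Finset α)}
    (hp : ∀ b ∈ B, p ∉ b) : Set.InjOn (adjoinOn p C) B := by
  intro b hb c hc h
  ext x
  have hx : x ∈ adjoinOn p C b ↔ x ∈ adjoinOn p C c := by rw [h]
  rw [mem_adjoinOn, mem_adjoinOn] at hx
  by_cases hxp : x = p
  · subst hxp
    exact iff_of_false (hp b hb) (hp c hc)
  · simpa [hxp] using hx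

/-- Adjoining a new point to all blocks of a parallel class of a PBD yields a PBD. -/
theorem IsPBD.image_adjoinOn {α : Type*} [DecidableEq α] {P : Finset α}
    {B C : Finset (Finset α)} (h : IsPBD P B) (hCB : C ⊆ B)
    (hC : ∀ x ∈ P, ∃! b, b ∈ C ∧ x ∈ b) {p : α} (hp : p ∉ P) :
    IsPBD (insert p P) (B.image (adjoinOn p C)) := by
  have hpB : ∀ b ∈ B, p ∉ b := fun b hb hpb => hp ((h.1 b hb).1 hpb)
  have hnew : ∀ y ∈ P, ∃! b, b ∈ B.image (adjoinOn p C) ∧ p ∈ b ∧ y ∈ b := by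
    intro y hy
    have hyp : y ≠ p := fun e => hp (e ▸ hy)
    obtain ⟨b, ⟨hb, hyb⟩, hu⟩ := hC y hy
    refine ⟨adjoinOn p C b, ⟨Finset.mem_image_of_mem _ (hCB hb),
      mem_adjoinOn.2 (.inl ⟨rfl, hb⟩), mem_adjoinOn.2 (.inr hyb)⟩, ?_⟩
    rintro _ ⟨hc, hpc, hyc⟩
    obtain ⟨c, hcB, rfl⟩ := Finset.mem_image.1 hc
    rw [mem_adjoinOn] at hpc hyc
    have hcC : c ∈ C := (hpc.resolve_right (hpB c hcB)).2
    rw [hu c ⟨hcC, hyc.resolve_left fun e => hyp e.1⟩]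
  refine ⟨?_, ?_⟩
  · intro b' hb'
    obtain ⟨b, hb, rfl⟩ := Finset.mem_image.1 hb'
    obtain ⟨hbP, hb2⟩ := h.1 b hb
    refine ⟨fun x hx => ?_, ?_⟩
    · rcases mem_adjoinOn.1 hx with hx | hx
      · exact Finset.mem_insert.2 (.inl hx.1)
      · exact Finset.mem_insert_of_mem (hbP hx)
    · rw [card_adjoinOn (hpB b hb)]
      omega
  · intro x hx y hy hxy
    rcases Finset.mem_insert.1 hx with rfl | hxP
    · exact hnew y (Finset.mem_of_mem_insert_of_ne hy hxy.symm)
    · rcases Finset.mem_insert.1 hy with rfl | hyP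
      · simpa only [and_comm (a := x ∈ _)] using hnew x hxP
      · have hxp : x ≠ p := fun e => hp (e ▸ hxP)
        have hyp : y ≠ p := fun e => hp (e ▸ hyP)
        obtain ⟨b, ⟨hb, hxb, hyb⟩, hu⟩ := h.2 x hxP y hyP hxy
        refine ⟨adjoinOn p C b, ⟨Finset.mem_image_of_mem _ hb,
          mem_adjoinOn.2 (.inr hxb), mem_adjoinOn.2 (.inr hyb)⟩, ?_⟩
        rintro _ ⟨hc, hxc, hyc⟩
        obtain ⟨c, hcB, rfl⟩ := Finset.mem_image.1 hc
        rw [mem_adjoinOn] at hxc hyc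
        rw [hu c ⟨hcB, hxc.resolve_left fun e => hxp e.1,
          hyc.resolve_left fun e => hyp e.1⟩]

theorem exists_pbd_of_resolvable_design (q : ℕ) (hq : 3 ≤ q)
    (hdes : ∃ (P : Finset ℕ) (B : Finset (Finset ℕ)),
      IsResolvableDesign P B (q ^ 2) q) :
    ∃ (P : Finset ℕ) (B : Finset (Finset ℕ)), P.card = q ^ 2 + 1 ∧ IsPBD P B ∧
      (∀ b ∈ B, b.card ≤ q + 1) ∧
      ∑ b ∈ B, b.card = q ^ 3 + q ^ 2 + q ∧
      ∑ b ∈ B, b.card = (q ^ 2 + 1) * (Nat.sqrt (q ^ 2 + 1) + 1) - 1 := by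
  obtain ⟨P, B, hP, hPBD, hk, I, cls, hcls, hpart⟩ := hdes
  have hthrough : ∀ x ∈ P, (B.filter (x ∈ ·)).card = q + 1 := by
    intro x hx
    have h := hPBD.card_blocks_through_mul hk hx
    rw [hP, show q ^ 2 - 1 = (q + 1) * (q - 1) by simpa using Nat.sq_sub_sq q 1] at h
    exact Nat.eq_of_mul_eq_mul_right (by omega) h
  have hsumB : ∑ b ∈ B, b.card = q ^ 2 * (q + 1) := by
    rw [sum_card_eq_card_mul (fun b hb => (hPBD.1 b hb).1) hthrough, hP]
  obtain ⟨x, hx⟩ : P.Nonempty := Finset.card_pos.1 (by rw [hP]; positivity)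
  obtain ⟨b, hb⟩ : (B.filter (x ∈ ·)).Nonempty :=
    Finset.card_pos.1 (by rw [hthrough x hx]; omega)
  obtain ⟨i, ⟨hi, -⟩, -⟩ := hpart b (Finset.mem_filter.1 hb).1
  obtain ⟨hCB, hC⟩ := hcls i hi
  have hcardC : (cls i).card = q := by
    have h1 : ∀ x ∈ P, ((cls i).filter (x ∈ ·)).card = 1 := by
      intro x hx
      obtain ⟨b, hb, hu⟩ := hC x hx
      refine Finset.card_eq_one.2 ⟨b, ?_⟩
      ext c
      simp only [Finset.mem_filter, Finset.mem_singleton]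
      exact ⟨fun hc => hu c hc, fun hc => hc ▸ hb⟩
    have h := sum_card_eq_card_mul (fun b hb => (hPBD.1 b (hCB hb)).1) h1
    rw [Finset.sum_congr rfl fun b hb => hk b (hCB hb), Finset.sum_const, smul_eq_mul,
      hP, mul_one, sq] at h
    exact Nat.eq_of_mul_eq_mul_right (by omega) h
  obtain ⟨p, hp⟩ := Infinite.exists_notMem_finset P
  have hpB : ∀ b ∈ B, p ∉ b := fun b hb hpb => hp ((hPBD.1 b hb).1 hpb)
  have hsum : ∑ b ∈ B.image (adjoinOn p (cls i)), b.card = q ^ 3 + q ^ 2 + q := by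
    rw [Finset.sum_image (adjoinOn_injOn hpB),
      Finset.sum_congr rfl fun b hb => card_adjoinOn (hpB b hb), Finset.sum_add_distrib,
      hsumB, Finset.sum_ite_mem, Finset.inter_eq_right.2 hCB, Finset.sum_const, hcardC,
      smul_eq_mul]
    ring
  refine ⟨insert p P, B.image (adjoinOn p (cls i)), ?_, hPBD.image_adjoinOn hCB hC hp, ?_,
    hsum, ?_⟩
  · rw [Finset.card_insert_of_notMem hp, hP]
  · intro b' hb'
    obtain ⟨b, hb, rfl⟩ := Finset.mem_image.1 hb'
    rw [card_adjoinOn (hpB b hb), hk b hb]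
    split_ifs <;> omega
  · have hsqrt : Nat.sqrt (q ^ 2 + 1) = q := by
      rw [sq]
      exact Nat.sqrt_add_eq q (by omega)
    rw [hsum, hsqrt]
    refine Nat.eq_sub_of_add_eq ?_
    ring
end

section
/- Let n ≥ 10, let H be a simple graph on a vertex set S of m vertices contained in the vertex set of K_n, and let K_n − H denote the graph on n vertices obtained from K_n by deleting the edges of H. If the clique number of H satisfies ω(H) ≤ n − (√n + 1)/2 and the clique number of the complement of H on S satisfies ω(H̄) ≤ m − (√n + 1)/2 (both as real inequalities), then scp(K_n − H) + scp(H) ≥ n(⌊√n⌋ + 1) − 1. -/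
/-- By concavity, the cubic lower bound for `n - 1` times the size of a clique partition with a
clique of size `x` exceeds `T` on an interval as soon as it does at both endpoints. -/
theorem cubic_pos_of_endpoints_pos {n T a b x : ℝ} (ha : 1 ≤ a) (hax : a ≤ x) (hxb : x ≤ b)
    (hga : 0 < (n - 1) * (a + a * (n - a)) + a ^ 2 * (n - a) - T)
    (hgb : 0 < (n - 1) * (b + b * (n - b)) + b ^ 2 * (n - b) - T) :
    0 < (n - 1) * (x + x * (n - x)) + x ^ 2 * (n - x) - T := by
  rcases hax.eq_or_lt with rfl | hlt
  · exact hga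
  have hab : 0 < b - a := by linarith
  have h3 : 0 ≤ (b - a) * ((x - a) * (b - x) * (x + a + b - 1)) := by
    have : 0 ≤ x - a := by linarith
    have : 0 ≤ b - x := by linarith
    have : 0 ≤ x + a + b - 1 := by linarith
    positivity
  have h1 := mul_nonneg (sub_nonneg.2 hxb) hga.le
  have h2 := mul_pos (sub_pos.2 hlt) hgb
  refine pos_of_mul_pos_right (b := _) (a := b - a) ?_ hab.le
  linear_combination h1 + h2 + h3

theorem le_of_sqrt_lt_of_sq_mul_le {n s k M : ℕ} (hn : 10 ≤ n) (hs : s * s ≤ n)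
    (hs' : n ≤ s * s + 2 * s) (hk : 2 * k + s + 1 ≤ 2 * n) (hk3 : k + 3 ≤ n) (hsk : s + 1 ≤ k)
    (hsk' : s + 2 ≤ k ∨ n ≤ s * s + 1) (hM : k ^ 2 * (n - k) ≤ M * (n - 1)) :
    n * (s + 1) ≤ k + k * (n - k) + M + 1 := by
  by_cases h5 : s ≤ 4
  · have : 3 ≤ s := by nlinarith
    interval_cases s
    all_goals
      interval_cases n <;> first
        | omega
        | have hk' : k ≤ 21 := by omega
          interval_cases k <;> omega
  by_contra! hcon
  have hkn : k ≤ n := by omega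
  have h5' : (5 : ℝ) ≤ s := by exact_mod_cast (by omega : 5 ≤ s)
  have hs_r : (s : ℝ) * s ≤ n := by exact_mod_cast hs
  have hs_r' : (n : ℝ) ≤ s * s + 2 * s := by exact_mod_cast hs'
  have hk_r : (k : ℝ) ≤ n - (s + 1) / 2 := by
    have : (2 * k + s + 1 : ℝ) ≤ 2 * n := by exact_mod_cast hk
    linarith
  have hM_r : (k : ℝ) ^ 2 * (n - k) ≤ M * (n - 1) := by
    have : ((k ^ 2 * (n - k) : ℕ) : ℝ) ≤ (M * (n - 1) : ℕ) := by exact_mod_cast hM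
    push_cast [Nat.cast_sub hkn, Nat.cast_sub (by omega : 1 ≤ n)] at this
    exact this
  have hcon_r : (k : ℝ) + k * (n - k) + M ≤ n * (s + 1) - 2 := by
    have : ((k + k * (n - k) + M + 2 : ℕ) : ℝ) ≤ (n * (s + 1) : ℕ) := by exact_mod_cast hcon
    push_cast [Nat.cast_sub hkn] at this
    linarith
  have hgk : ((n : ℝ) - 1) * (k + k * (n - k)) + k ^ 2 * (n - k)
      - (n - 1) * (n * (s + 1) - 2) ≤ 0 := by
    have := mul_le_mul_of_nonneg_left hcon_r (by nlinarith : (0 : ℝ) ≤ n - 1)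
    linarith
  have hgb : 0 < ((n : ℝ) - 1) * ((n - (s + 1) / 2) + (n - (s + 1) / 2) * (n - (n - (s + 1) / 2)))
      + (n - (s + 1) / 2) ^ 2 * (n - (n - (s + 1) / 2)) - (n - 1) * (n * (s + 1) - 2) := by
    obtain ⟨t, ht⟩ : ∃ t : ℝ, (s : ℝ) = t + 5 := ⟨s - 5, by ring⟩
    obtain ⟨u, hu⟩ : ∃ u : ℝ, (n : ℝ) = s * s + u := ⟨n - s * s, by ring⟩
    have ht0 : 0 ≤ t := by linarith
    have hu0 : 0 ≤ u := by linarith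
    rw [hu, ht]
    ring_nf
    positivity
  refine hgk.not_gt ?_
  by_cases h2 : n ≤ s * s + 1
  · refine cubic_pos_of_endpoints_pos (a := s + 1) (by linarith) (by exact_mod_cast hsk) hk_r ?_ hgb
    obtain ⟨t, ht⟩ : ∃ t : ℝ, (s : ℝ) = t + 5 := ⟨s - 5, by ring⟩
    have ht0 : 0 ≤ t := by linarith
    obtain h | h : n = s * s ∨ n = s * s + 1 := by omega
    all_goals
      rw [h]
      push_cast
      rw [ht]
      ring_nf
      positivity
  · refine cubic_pos_of_endpoints_pos (a := s + 2) (by linarith)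
      (by exact_mod_cast (hsk'.resolve_right h2)) hk_r ?_ hgb
    have h2_r : (s : ℝ) * s + 2 ≤ n := by exact_mod_cast (by omega : s * s + 2 ≤ n)
    obtain ⟨t, ht⟩ : ∃ t : ℝ, (s : ℝ) = t + 5 := ⟨s - 5, by ring⟩
    obtain ⟨u, hu⟩ : ∃ u : ℝ, (n : ℝ) = s * s + 2 + u := ⟨n - (s * s + 2), by ring⟩
    have ht0 : 0 ≤ t := by linarith
    have hu0 : 0 ≤ u := by linarith
    rw [hu, ht]
    ring_nf
    positivity

namespace IsCliquePartition

variable {V : Type*} [DecidableEq V] {C : Finset (Finset V)}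

theorem union_top {H : SimpleGraph V} {A B : Finset (Finset V)}
    (hA : IsCliquePartition (⊤ \ H) A) (hB : IsCliquePartition H B) :
    IsCliquePartition ⊤ (A ∪ B) := by
  refine ⟨fun c _ x _ y _ hxy => hxy, fun x y hxy => ?_⟩
  by_cases h : H.Adj x y
  · obtain ⟨c, ⟨hc, hx, hy⟩, hu⟩ := hB.2 x y h
    refine ⟨c, ⟨Finset.mem_union_right _ hc, hx, hy⟩, ?_⟩
    rintro c' ⟨hc', hx', hy'⟩
    rcases Finset.mem_union.1 hc' with h' | h'
    · exact absurd h (hA.1 c' h' hx' hy' hxy).2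
    · exact hu c' ⟨h', hx', hy'⟩
  · obtain ⟨c, ⟨hc, hx, hy⟩, hu⟩ := hA.2 x y ⟨hxy, h⟩
    refine ⟨c, ⟨Finset.mem_union_left _ hc, hx, hy⟩, ?_⟩
    rintro c' ⟨hc', hx', hy'⟩
    rcases Finset.mem_union.1 hc' with h' | h'
    · exact hu c' ⟨h', hx', hy'⟩
    · exact absurd (hB.1 c' h' hx' hy' hxy) h

theorem sum_card_filter_pairs (hC : IsCliquePartition ⊤ C) (P : Finset (V × V))
    (hP : ∀ p ∈ P, p.1 ≠ p.2) :
    ∑ c ∈ C, (P.filter fun p => p.1 ∈ c ∧ p.2 ∈ c).card = P.card := by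
  have h := Finset.sum_card_bipartiteAbove_eq_sum_card_bipartiteBelow
    (s := C) (t := P) fun c p => p.1 ∈ c ∧ p.2 ∈ c
  simp only [Finset.bipartiteAbove, Finset.bipartiteBelow] at h
  rw [h, Finset.card_eq_sum_ones]
  refine Finset.sum_congr rfl fun p hp => ?_
  obtain ⟨c, hc, hu⟩ := hC.2 p.1 p.2 (hP p hp)
  refine Finset.card_eq_one.2 ⟨c, ?_⟩
  ext c'
  rw [Finset.mem_filter, Finset.mem_singleton]
  exact ⟨hu c', fun h' => h' ▸ hc⟩

theorem card_sub_one_eq_sum [Fintype V] (hC : IsCliquePartition ⊤ C) (v : V) :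
    ∑ c ∈ C with v ∈ c, (c.card - 1) = Fintype.card V - 1 := by
  have h := hC.sum_card_filter_pairs ({v} ×ˢ Finset.univ.erase v) (by simp; grind)
  rw [Finset.card_product, Finset.card_singleton, one_mul,
    Finset.card_erase_of_mem (Finset.mem_univ v), Finset.card_univ] at h
  rw [← h, Finset.sum_filter]
  refine Finset.sum_congr rfl fun c _ => ?_
  split_ifs with hv
  · rw [← Finset.card_erase_of_mem hv, ← one_mul (c.erase v).card, ← Finset.card_singleton v,
      ← Finset.card_product]
    congr 1
    ext ⟨x, y⟩
    simp
    grind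
  · symm
    rw [Finset.card_eq_zero]
    ext ⟨x, y⟩
    simp
    grind

/-- If all cliques have at most `b + 1` vertices and `r` cliques of that size are not enough to
cover the neighbours of a vertex, then every vertex lies in at least `r + 1` cliques. -/
theorem card_mul_le_sum_card [Fintype V] (hC : IsCliquePartition ⊤ C) {b r : ℕ}
    (hb : ∀ c ∈ C, c.card ≤ b + 1) (hr : r * b < Fintype.card V - 1) :
    Fintype.card V * (r + 1) ≤ ∑ c ∈ C, c.card := by
  have h := Finset.sum_card_bipartiteAbove_eq_sum_card_bipartiteBelow
    (s := C) (t := (Finset.univ : Finset V)) fun c v => v ∈ c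
  simp only [Finset.bipartiteAbove, Finset.bipartiteBelow, Finset.filter_univ_mem] at h
  rw [h, ← Finset.card_univ, ← smul_eq_mul]
  refine Finset.card_nsmul_le_sum _ _ _ fun v _ => ?_
  by_contra! hlt
  have h1 := Finset.sum_le_card_nsmul (C.filter (v ∈ ·)) (fun c => c.card - 1) b
    fun c hc => by have := hb c (Finset.mem_filter.1 hc).1; omega
  rw [hC.card_sub_one_eq_sum v, smul_eq_mul] at h1
  have := Nat.mul_le_mul_right b (Nat.lt_succ_iff.1 hlt)
  omega

theorem card_inter_le_one (hC : IsCliquePartition ⊤ C) {c L : Finset V} (hc : c ∈ C) (hL : L ∈ C)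
    (hne : c ≠ L) : (c ∩ L).card ≤ 1 := by
  refine Finset.card_le_one.2 fun x hx y hy => by_contra fun hxy => hne ?_
  rw [Finset.mem_inter] at hx hy
  exact (hC.2 x y hxy).unique ⟨hc, hx.1, hy.1⟩ ⟨hL, hx.2, hy.2⟩

/-- The cliques `c ≠ L` that meet the clique `L` number at least `|L|² (n - |L|) / (n - 1)`. -/
theorem exists_le_sum_card [Fintype V] (hC : IsCliquePartition ⊤ C) {L : Finset V} (hL : L ∈ C)
    (hLV : L.card < Fintype.card V) :
    ∃ M : ℕ, L.card ^ 2 * (Fintype.card V - L.card) ≤ M * (Fintype.card V - 1) ∧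
      L.card + L.card * (Fintype.card V - L.card) + M ≤ ∑ c ∈ C, c.card := by
  set d := Fintype.card V - L.card with hd
  have hLc : Lᶜ.card = d := Finset.card_compl L
  set D := (C.erase L).filter fun c => (c ∩ L).Nonempty with hD
  have hD1 : ∀ c ∈ D, (c ∩ L).card = 1 := fun c hc => by
    have h := Finset.mem_filter.1 hc
    exact le_antisymm (hC.card_inter_le_one (Finset.mem_of_mem_erase h.1) hL
      (Finset.ne_of_mem_erase h.1)) h.2.card_pos
  have hDC : D ⊆ C := (Finset.filter_subset _ _).trans (Finset.erase_subset _ _)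
  have hcross : ∑ c ∈ D, (c \ L).card = L.card * d := by
    rw [← hLc, ← Finset.card_product, ← hC.sum_card_filter_pairs (L ×ˢ Lᶜ) (by simp; grind)]
    have : ∀ c : Finset V, ((L ×ˢ Lᶜ).filter fun p => p.1 ∈ c ∧ p.2 ∈ c).card
        = (c ∩ L).card * (c \ L).card := fun c => by
      rw [← Finset.card_product]
      congr 1
      ext ⟨x, y⟩
      simp
      tauto
    simp only [this]
    rw [← Finset.sum_subset hDC]
    · exact Finset.sum_congr rfl fun c hc => by rw [hD1 c hc, one_mul]
    · intro c hc hcD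
      by_cases hcL : c = L
      · simp [hcL]
      · have : c ∩ L = ∅ := by
          rw [← Finset.not_nonempty_iff_eq_empty]
          exact fun h => hcD (Finset.mem_filter.2 ⟨Finset.mem_erase.2 ⟨hcL, hc⟩, h⟩)
        simp [this]
  have hsq : ∑ c ∈ D, ((c \ L).card * (c \ L).card - (c \ L).card) ≤ d * d - d := by
    rw [← hLc, ← Finset.offDiag_card, ← hC.sum_card_filter_pairs Lᶜ.offDiag (by simp)]
    refine (Finset.sum_le_sum_of_subset hDC).trans (Finset.sum_le_sum fun c _ => ?_)
    rw [← Finset.offDiag_card]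
    refine Finset.card_le_card fun ⟨x, y⟩ => ?_
    simp
    tauto
  refine ⟨D.card, ?_, ?_⟩
  · have hcs := sq_sum_le_card_mul_sum_sq (s := D) (f := fun c => (c \ L).card)
    have hsum : ∑ c ∈ D, (c \ L).card ^ 2 ≤ d * (Fintype.card V - 1) := by
      have : ∑ c ∈ D, (c \ L).card ^ 2 = ∑ c ∈ D, ((c \ L).card * (c \ L).card - (c \ L).card)
          + ∑ c ∈ D, (c \ L).card := by
        rw [← Finset.sum_add_distrib]
        refine Finset.sum_congr rfl fun c _ => ?_
        rw [Nat.sub_add_cancel (Nat.le_mul_self _), sq]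
      rw [this, hcross]
      calc _ ≤ d * d - d + L.card * d := Nat.add_le_add_right hsq _
        _ = d * (Fintype.card V - 1) := by
          have h1 : Fintype.card V - 1 = (d - 1) + L.card := by omega
          rw [h1, mul_add, Nat.mul_sub_one, mul_comm L.card]
    rw [hcross] at hcs
    refine le_of_mul_le_mul_left (a := d) ?_ (Nat.sub_pos_of_lt hLV)
    calc d * (L.card ^ 2 * d) = (L.card * d) ^ 2 := by ring
      _ ≤ D.card * (d * (Fintype.card V - 1)) := hcs.trans (Nat.mul_le_mul_left _ hsum)
      _ = _ := by ring
  · have hDL : ∑ c ∈ D, c.card = D.card + L.card * d := by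
      rw [← hcross, Finset.card_eq_sum_ones, ← Finset.sum_add_distrib]
      refine Finset.sum_congr rfl fun c hc => ?_
      rw [← hD1 c hc, Finset.card_inter_add_card_sdiff]
    have hLD : L ∉ D := by simp [hD]
    calc _ = ∑ c ∈ insert L D, c.card := by rw [Finset.sum_insert hLD, hDL]; ring
      _ ≤ _ := Finset.sum_le_sum_of_subset (Finset.insert_subset hL hDC)

end IsCliquePartition

theorem scp_complete_sub_graph_lower {V : Type*} [Fintype V] [DecidableEq V]
    (n m : ℕ) (hn : 10 ≤ n) (hcard : Fintype.card V = n)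
    (S : Finset V) (hS : S.card = m)
    (H : SimpleGraph V) (hHS : ∀ x y, H.Adj x y → x ∈ S ∧ y ∈ S)
    (hω : ∀ t : Finset V, H.IsClique (t : Set V) →
      (t.card : ℝ) ≤ n - (Real.sqrt n + 1) / 2)
    (hω' : ∀ t : Finset V, ↑t ⊆ (S : Set V) →
      (∀ x ∈ t, ∀ y ∈ t, x ≠ y → ¬H.Adj x y) →
      (t.card : ℝ) ≤ m - (Real.sqrt n + 1) / 2) :
    n * (Nat.sqrt n + 1) - 1 ≤ scp ((⊤ : SimpleGraph V) \ H) + scp H := by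
  obtain ⟨A, hA, hAs⟩ := exists_isCliquePartition_sum_eq_scp ((⊤ : SimpleGraph V) \ H)
  obtain ⟨B, hB, hBs⟩ := exists_isCliquePartition_sum_eq_scp H
  have hC := hA.union_top hB
  have hsum : ∑ c ∈ A ∪ B, c.card ≤ scp ((⊤ : SimpleGraph V) \ H) + scp H := by
    rw [hAs, hBs, ← Finset.sum_union_inter]
    exact Nat.le_add_right _ _
  have hsize : ∀ c ∈ A ∪ B, (c.card : ℝ) ≤ n - (Real.sqrt n + 1) / 2 := by
    intro c hc
    rcases Finset.mem_union.1 hc with hc | hc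
    · have h1 := hω' (c ∩ S) (by simp) fun x hx y hy hxy =>
        (hA.1 c hc (Finset.mem_inter.1 hx).1 (Finset.mem_inter.1 hy).1 hxy).2
      have h2 : c.card + m ≤ (c ∩ S).card + n := by
        rw [← Finset.card_inter_add_card_sdiff c S, add_assoc, ← hS, ← hcard, ← Finset.card_univ,
          Nat.add_le_add_iff_left, ← Finset.card_union_of_disjoint Finset.sdiff_disjoint]
        exact Finset.card_le_card (Finset.subset_univ _)
      have h3 : (c.card : ℝ) + m ≤ (c ∩ S).card + n := by exact_mod_cast h2
      linarith
    · exact hω c (hB.1 c hc)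
  refine le_trans ?_ hsum
  have hs : n.sqrt * n.sqrt ≤ n := Nat.sqrt_le n
  have hs' : n ≤ n.sqrt * n.sqrt + 2 * n.sqrt := by have := Nat.sqrt_le_add n; omega
  have hs3 : 3 ≤ n.sqrt := Nat.le_sqrt.2 (by omega)
  have hr : (n.sqrt : ℝ) ≤ √n := Real.nat_sqrt_le_real_sqrt
  have hr3 : (3 : ℝ) < √n := Real.lt_sqrt_of_sq_lt (by norm_num; exact_mod_cast (by omega : 9 < n))
  generalize n.sqrt = s at *
  by_cases hbig : ∃ L ∈ A ∪ B, s + 1 ≤ L.card ∧ (s + 2 ≤ L.card ∨ n ≤ s * s + 1)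
  · obtain ⟨L, hL, hL1, hL2⟩ := hbig
    have hk := hsize L hL
    have hk2 : 2 * L.card + s + 1 ≤ 2 * n := by
      have : (2 * L.card + s + 1 : ℝ) ≤ 2 * n := by linarith
      exact_mod_cast this
    have hk3 : L.card + 3 ≤ n := by
      have : (L.card : ℝ) + 2 < n := by linarith
      have : L.card + 2 < n := by exact_mod_cast this
      exact this
    obtain ⟨M, hM, hle⟩ := hC.exists_le_sum_card hL (by omega)
    rw [hcard] at hM hle
    have := le_of_sqrt_lt_of_sq_mul_le hn hs hs' hk2 hk3 hL1 hL2 hM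
    omega
  · push Not at hbig
    refine (Nat.sub_le _ _).trans ?_
    rw [← hcard]
    obtain ⟨p, rfl⟩ : ∃ p, s = p + 1 := ⟨s - 1, by omega⟩
    by_cases hns : n ≤ (p + 1) * (p + 1) + 1
    · refine hC.card_mul_le_sum_card (b := p) (fun c hc => ?_) ?_
      · by_contra! hlt
        have := (hbig c hc hlt).2
        omega
      · rw [hcard]
        have : (p + 1) * (p + 1) = (p + 1) * p + p + 1 := by ring
        omega
    · refine hC.card_mul_le_sum_card (b := p + 1) (fun c hc => ?_) (by omega)
      by_contra! hlt
      have := (hbig c hc (by omega)).1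
      omega
end
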